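/- arXiv:1302.6144 — 2 statements merged into one kernel-verified Lean document; each statement's English description precedes it below -/
import Mathlib

section
/- (Vaaler/Beurling–Selberg approximation, consequence) Let f be a function on the circle ℝ/ℤ of bounded variation V(f). For every positive integer κ there exist trigonometric polynomials P⁻, P⁺ of degree at most κ such that P⁻ ≤ f ≤ P⁺ pointwise and ∫_{ℝ/ℤ} (P⁺ − P⁻) = V(f)/(κ+1). In particular ‖P^±‖_1 ≤ ‖f‖_1 + V(f)/(κ+1). -/
open MeasureTheory

/-- `P` is a (complex-exponential) trigonometric polynomial of degree at most `κ`,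
viewed as a real-valued function on `ℝ/ℤ`. -/
def IsTrigPolyDeg (κ : ℕ) (P : ℝ → ℝ) : Prop :=
  ∃ c : ℤ → ℂ, ∀ x : ℝ,
    (P x : ℂ) = ∑ n ∈ Finset.Icc (-(κ : ℤ)) (κ : ℤ),
      c n * Complex.exp (2 * (Real.pi : ℂ) * Complex.I * (n : ℂ) * (x : ℂ))

/-- The complex trigonometric polynomial with coefficients `c`. -/
noncomputable def TP (n : ℕ) (c : ℤ → ℂ) (x : ℝ) : ℂ :=
  ∑ m ∈ Finset.Icc (-(n : ℤ)) (n : ℤ),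
      c m * Complex.exp (2 * (Real.pi : ℂ) * Complex.I * (m : ℂ) * (x : ℂ))

/-- Coefficients of the derivative. -/
noncomputable def dc (c : ℤ → ℂ) : ℤ → ℂ := fun m => 2 * (Real.pi : ℂ) * Complex.I * (m : ℂ) * c m

lemma TP_hasDerivAt (n : ℕ) (c : ℤ → ℂ) (x : ℝ) : HasDerivAt (TP n c) (TP n (dc c) x) x := by
  unfold TP
  apply HasDerivAt.fun_sum
  intro m _
  have h1 : HasDerivAt (fun x : ℝ => 2 * (Real.pi : ℂ) * Complex.I * (m : ℂ) * (x : ℂ))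
      (2 * (Real.pi : ℂ) * Complex.I * (m : ℂ)) x := by
    simpa using (Complex.ofRealCLM.hasDerivAt (x := x)).const_mul
      (2 * (Real.pi : ℂ) * Complex.I * (m : ℂ))
  have h2 := (h1.cexp).const_mul (c m)
  have e : c m * (Complex.exp (2 * (Real.pi : ℂ) * Complex.I * (m : ℂ) * (x : ℂ)) *
      (2 * (Real.pi : ℂ) * Complex.I * (m : ℂ))) =
      dc c m * Complex.exp (2 * (Real.pi : ℂ) * Complex.I * (m : ℂ) * (x : ℂ)) := by
    simp only [dc]; ring
  rw [e] at h2
  exact h2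

lemma TP_re_hasDerivAt (n : ℕ) (c : ℤ → ℂ) (x : ℝ) :
    HasDerivAt (fun x => (TP n c x).re) (TP n (dc c) x).re x := by
  have := Complex.reCLM.hasFDerivAt.comp_hasDerivAt x (TP_hasDerivAt n c x)
  exact this

lemma TP_mul (n : ℕ) (c : ℤ → ℂ) (x : ℝ) :
    TP n c x * Complex.exp (2 * (Real.pi : ℂ) * Complex.I * (x : ℂ)) ^ n =
    ∑ j ∈ Finset.range (2 * n + 1), c ((j : ℤ) - n) *
      Complex.exp (2 * (Real.pi : ℂ) * Complex.I * (x : ℂ)) ^ j := by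
  unfold TP
  rw [Finset.sum_mul]
  refine Finset.sum_nbij' (fun m => (m + n).toNat) (fun j => (j : ℤ) - n) ?_ ?_ ?_ ?_ ?_
  · intro m hm; simp at hm ⊢; omega
  · intro m hm; simp at hm ⊢; omega
  · intro m hm; simp at hm ⊢; omega
  · intro m hm; simp at hm ⊢
  · intro m hm
    simp only [Finset.mem_Icc] at hm
    obtain ⟨j, hj⟩ : ∃ j : ℕ, m = (j : ℤ) - n := ⟨(m + n).toNat, by omega⟩
    subst hj
    simp only [sub_add_cancel, Int.toNat_natCast]
    rw [mul_assoc, ← Complex.exp_nat_mul, ← Complex.exp_nat_mul, ← Complex.exp_add]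
    congr 2
    push_cast; ring

lemma e_inj {s t : ℝ} (hs : s ∈ Set.Ico (0:ℝ) 1) (ht : t ∈ Set.Ico (0:ℝ) 1)
    (h : Complex.exp (2 * (Real.pi : ℂ) * Complex.I * (s : ℂ)) =
      Complex.exp (2 * (Real.pi : ℂ) * Complex.I * (t : ℂ))) : s = t := by
  rw [Complex.exp_eq_exp_iff_exists_int] at h
  obtain ⟨k, hk⟩ := h
  have h2 : (2 * (Real.pi : ℂ) * Complex.I) * ((s : ℂ) - t - k) = 0 := by linear_combination hk
  have h3 : (s : ℂ) - t - k = 0 := by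
    rcases mul_eq_zero.1 h2 with h | h
    · exact absurd h (by simp [Real.pi_ne_zero])
    · exact h
  have h4 : s - t - k = 0 := by exact_mod_cast h3
  have : k = 0 := by
    have h5 : (k : ℝ) < 1 := by linarith [hs.1, hs.2, ht.1, ht.2]
    have h6 : (-1 : ℝ) < k := by linarith [hs.1, hs.2, ht.1, ht.2]
    have h5' : k < 1 := by exact_mod_cast h5
    have h6' : -1 < k := by exact_mod_cast h6
    omega
  subst this
  simp at h4; linarith

lemma coeff_zero_of_zeros (n : ℕ) (c : ℤ → ℂ) (T D : Finset ℝ)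
    (hT : ∀ t ∈ T, t ∈ Set.Ico (0:ℝ) 1 ∧ TP n c t = 0) (hDT : D ⊆ T)
    (hD : ∀ t ∈ D, TP n (dc c) t = 0) (hcard : 2 * n + 1 ≤ T.card + D.card) :
    ∀ m ∈ Finset.Icc (-(n:ℤ)) n, c m = 0 := by
  classical
  set e : ℝ → ℂ := fun x => Complex.exp (2 * (Real.pi : ℂ) * Complex.I * (x : ℂ)) with he
  have hene : ∀ x, e x ≠ 0 := fun x => Complex.exp_ne_zero _
  let p : Polynomial ℂ := ∑ j ∈ Finset.range (2 * n + 1), Polynomial.monomial j (c ((j : ℤ) - n))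
  have hpc : ∀ j < 2 * n + 1, p.coeff j = c ((j : ℤ) - n) := by
    intro j hj
    simp only [p, Polynomial.finsetSum_coeff, Polynomial.coeff_monomial]
    rw [Finset.sum_ite_eq' ]
    simp [hj]
  have hpdeg : p.degree < ((2 * n + 1 : ℕ) : WithBot ℕ) := by
    rw [Polynomial.degree_lt_iff_coeff_zero]
    intro j hj
    simp only [p, Polynomial.finsetSum_coeff, Polynomial.coeff_monomial]
    rw [Finset.sum_ite_eq' ]
    simp; omega
  have hev : ∀ t ∈ T, p.IsRoot (e t) := by
    intro t ht
    have := TP_mul n c t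
    rw [(hT t ht).2, zero_mul] at this
    simp only [Polynomial.IsRoot, p, Polynomial.eval_finsetSum, Polynomial.eval_monomial]
    exact this.symm
  have hdev : ∀ t ∈ D, (Polynomial.derivative p).IsRoot (e t) := by
    intro t ht
    have h1 := TP_mul n c t
    rw [(hT t (hDT ht)).2, zero_mul] at h1
    have h2 := TP_mul n (dc c) t
    rw [hD t ht, zero_mul] at h2
    have h3 : (2 * (Real.pi : ℂ) * Complex.I) * (e t * (Polynomial.derivative p).eval (e t)) = 0 := by
      simp only [p, Polynomial.eval_finsetSum, Polynomial.derivative_sum,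
        Polynomial.derivative_monomial, Polynomial.eval_monomial]
      calc _ = (∑ j ∈ Finset.range (2 * n + 1), dc c ((j : ℤ) - n) * e t ^ j)
            + (2 * (Real.pi : ℂ) * Complex.I * n) *
              ∑ j ∈ Finset.range (2 * n + 1), c ((j : ℤ) - n) * e t ^ j := by
            rw [Finset.mul_sum, Finset.mul_sum, Finset.mul_sum, ← Finset.sum_add_distrib]
            apply Finset.sum_congr rfl
            intro j _
            rcases j with _ | j
            · simp [dc]; 
            · simp only [dc, Nat.add_sub_cancel, pow_succ]; push_cast; ring
        _ = 0 := by rw [← h1, ← h2]; simp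
    rcases mul_eq_zero.1 h3 with h | h
    · exact absurd h (by simp [Real.pi_ne_zero])
    · rcases mul_eq_zero.1 h with h | h
      · exact absurd h (hene t)
      · exact h
  have hinj : Set.InjOn e T := fun s hs t ht h => e_inj (hT s hs).1 (hT t ht).1 h
  have hp0 : p = 0 := by
    by_contra hp
    have hle : (T.image e).val + (D.image e).val ≤ p.roots := by
      rw [Multiset.le_iff_count]
      intro z
      rw [Multiset.count_add, Polynomial.count_roots]
      have c1 := Multiset.nodup_iff_count_le_one.1 (T.image e).nodup z
      have c2 := Multiset.nodup_iff_count_le_one.1 (D.image e).nodup z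
      by_cases hzD : z ∈ D.image e
      · obtain ⟨t, ht, rfl⟩ := Finset.mem_image.1 hzD
        have := (Polynomial.one_lt_rootMultiplicity_iff_isRoot hp).2 ⟨hev t (hDT ht), hdev t ht⟩
        omega
      · have c3 : Multiset.count z (D.image e).val = 0 := Multiset.count_eq_zero.2 hzD
        by_cases hzT : z ∈ T.image e
        · obtain ⟨t, ht, rfl⟩ := Finset.mem_image.1 hzT
          have := (Polynomial.rootMultiplicity_pos hp).2 (hev t ht)
          omega
        · have c4 : Multiset.count z (T.image e).val = 0 := Multiset.count_eq_zero.2 hzT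
          omega
    have h1 := Multiset.card_le_card hle
    rw [Multiset.card_add, Finset.card_val, Finset.card_val, Finset.card_image_of_injOn hinj,
      Finset.card_image_of_injOn (hinj.mono (by exact_mod_cast hDT))] at h1
    have h2 := Polynomial.card_roots' p
    have h3 := (Polynomial.natDegree_lt_iff_degree_lt hp).2 hpdeg
    omega
  intro m hm
  rw [Finset.mem_Icc] at hm
  have := hpc (m + n).toNat (by omega)
  rw [hp0] at this
  rw [Int.toNat_of_nonneg (by omega)] at this
  simpa using this.symm

lemma TP_congr (n : ℕ) {c d : ℤ → ℂ} (h : ∀ m ∈ Finset.Icc (-(n:ℤ)) n, c m = d m) :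
    TP n c = TP n d := by
  funext x
  unfold TP
  exact Finset.sum_congr rfl fun m hm => by rw [h m hm]

lemma TP_add (n : ℕ) (c d : ℤ → ℂ) (x : ℝ) : TP n (fun m => c m + d m) x = TP n c x + TP n d x := by
  simp [TP, add_mul, Finset.sum_add_distrib]

lemma TP_smul (n : ℕ) (a : ℂ) (c : ℤ → ℂ) (x : ℝ) : TP n (fun m => a * c m) x = a * TP n c x := by
  simp [TP, mul_assoc, Finset.mul_sum]

lemma TP_const (n : ℕ) (a : ℂ) (x : ℝ) : TP n (fun m => if m = 0 then a else 0) x = a := by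
  simp only [TP, ite_mul, zero_mul]
  rw [Finset.sum_ite_eq']
  simp

lemma TP_conj (n : ℕ) (c : ℤ → ℂ) (x : ℝ) :
    TP n (fun m => (starRingEnd ℂ) (c (-m))) x = (starRingEnd ℂ) (TP n c x) := by
  unfold TP
  rw [map_sum]
  refine Finset.sum_nbij' (fun m => -m) (fun m => -m) ?_ ?_ ?_ ?_ ?_
  · intro m hm; simp at hm ⊢; omega
  · intro m hm; simp at hm ⊢; omega
  · simp
  · simp
  · intro m _
    rw [map_mul, ← Complex.exp_conj]
    congr 2
    simp [map_mul, Complex.conj_ofNat]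

lemma TP_neg (n : ℕ) (c : ℤ → ℂ) (x : ℝ) : TP n (fun m => c (-m)) x = TP n c (-x) := by
  unfold TP
  refine Finset.sum_nbij' (fun m => -m) (fun m => -m) ?_ ?_ ?_ ?_ ?_
  · intro m hm; simp at hm ⊢; omega
  · intro m hm; simp at hm ⊢; omega
  · simp
  · simp
  · intro m _
    simp

lemma TP_shift (n : ℕ) (c : ℤ → ℂ) (x y : ℝ) :
    TP n (fun m => c m * Complex.exp (2 * (Real.pi : ℂ) * Complex.I * (m : ℂ) * (y : ℂ))) x
      = TP n c (x + y) := by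
  unfold TP
  refine Finset.sum_congr rfl fun m _ => ?_
  rw [mul_assoc, ← Complex.exp_add]
  congr 2
  push_cast; ring

lemma TP_periodic (n : ℕ) (c : ℤ → ℂ) (x : ℝ) : TP n c (x + 1) = TP n c x := by
  rw [← TP_shift]
  apply congrFun (TP_congr n _)
  intro m _
  have : Complex.exp (2 * (Real.pi : ℂ) * Complex.I * (m : ℂ) * ((1:ℝ) : ℂ)) = 1 := by
    rw [Complex.exp_eq_one_iff]
    exact ⟨m, by push_cast; ring⟩
  rw [this, mul_one]

/-- Coefficients of the real part. -/
noncomputable def rc (c : ℤ → ℂ) : ℤ → ℂ := fun m => (1/2) * (c m + (starRingEnd ℂ) (c (-m)))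

lemma TP_re (n : ℕ) (c : ℤ → ℂ) (x : ℝ) : TP n (rc c) x = ((TP n c x).re : ℂ) := by
  unfold rc
  rw [TP_smul, TP_add, TP_conj, Complex.add_conj]
  push_cast; ring

lemma TP_sum (n : ℕ) {ι : Type*} (s : Finset ι) (c : ι → ℤ → ℂ) (x : ℝ) :
    TP n (fun m => ∑ i ∈ s, c i m) x = ∑ i ∈ s, TP n (c i) x := by
  unfold TP
  rw [Finset.sum_comm]
  exact Finset.sum_congr rfl fun m _ => Finset.sum_mul _ _ _

lemma nonneg_of_count (n : ℕ) (g q r : ℝ → ℝ) (hg : ∀ x, HasDerivAt g (q x) x)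
    (hq : ∀ x, HasDerivAt q (r x) x) (h0 : g 0 = 1)
    (hz : ∀ k : ℕ, 1 ≤ k → k ≤ n + 1 → g (k / (n + 1)) = 0)
    (hqz : ∀ k : ℕ, 1 ≤ k → k ≤ n → q (k / (n + 1)) = 0)
    (count : ∀ T D : Finset ℝ, (∀ t ∈ T, t ∈ Set.Ico (0:ℝ) 1 ∧ q t = 0) → D ⊆ T →
      (∀ t ∈ D, r t = 0) → T.card + D.card ≤ 2 * n) :
    ∀ x ∈ Set.Icc (0:ℝ) 1, 0 ≤ g x := by
  classical
  set θ : ℕ → ℝ := fun k => k / (n + 1) with hθ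
  have hn1 : (0:ℝ) < n + 1 := by positivity
  have θmono : StrictMono θ := by
    intro a b hab
    have : (a:ℝ) < b := by exact_mod_cast hab
    simp only [hθ]; gcongr
  have θ0 : θ 0 = 0 := by simp [hθ]
  have θ1 : θ (n + 1) = 1 := by simp only [hθ]; push_cast; field_simp
  have gcont : Continuous g := continuous_iff_continuousAt.2 fun x => (hg x).continuousAt
  have rolle : ∀ a b, a < b → g a = 0 → g b = 0 → ∃ z ∈ Set.Ioo a b, q z = 0 := by
    intro a b hab ha hb
    exact exists_hasDerivAt_eq_zero hab gcont.continuousOn (by rw [ha, hb]) (fun x _ => hg x)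
  have hξ : ∀ k : ℕ, ∃ z, (1 ≤ k → k ≤ n → z ∈ Set.Ioo (θ k) (θ (k + 1)) ∧ q z = 0) := by
    intro k
    by_cases h : 1 ≤ k ∧ k ≤ n
    · obtain ⟨z, hz1, hz2⟩ := rolle (θ k) (θ (k+1)) (θmono (Nat.lt_succ_self k))
        (hz k h.1 (by omega)) (by have := hz (k+1) (by omega) (by omega); exact this)
      exact ⟨z, fun _ _ => ⟨hz1, hz2⟩⟩
    · exact ⟨0, fun h1 h2 => absurd ⟨h1, h2⟩ h⟩
  choose ξ hξ using hξ
  -- locating points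
  have loc : ∀ i j : ℕ, ∀ z, z ∈ Set.Ioo (θ i) (θ (i+1)) → z ∈ Set.Ioo (θ j) (θ (j+1)) → i = j := by
    intro i j z hi hj
    have h1 := θmono.lt_iff_lt.1 (hi.1.trans hj.2)
    have h2 := θmono.lt_iff_lt.1 (hj.1.trans hi.2)
    omega
  have loc' : ∀ i j : ℕ, θ j ∉ Set.Ioo (θ i) (θ (i+1)) := by
    intro i j hi
    have h1 := θmono.lt_iff_lt.1 hi.1
    have h2 := θmono.lt_iff_lt.1 hi.2
    omega
  let T₀ : Finset ℝ := (Finset.Icc 1 n).image θ ∪ (Finset.Icc 1 n).image ξ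
  have T₀card : T₀.card = 2 * n := by
    rw [Finset.card_union_of_disjoint, Finset.card_image_of_injective _ θmono.injective,
      Finset.card_image_of_injOn]
    · simp; ring
    · intro i hi j hj hij
      simp only [Finset.coe_Icc, Set.mem_Icc] at hi hj
      refine loc i j (ξ i) (hξ i hi.1 hi.2).1 ?_
      rw [hij]; exact (hξ j hj.1 hj.2).1
    · rw [Finset.disjoint_left]
      intro z h1 h2
      obtain ⟨i, hi, rfl⟩ := Finset.mem_image.1 h1
      obtain ⟨j, hj, hij⟩ := Finset.mem_image.1 h2
      rw [Finset.mem_Icc] at hj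
      exact loc' j i (hij ▸ (hξ j hj.1 hj.2).1)
  have T₀z : ∀ t ∈ T₀, t ∈ Set.Ico (0:ℝ) 1 ∧ q t = 0 := by
    intro t ht
    rcases Finset.mem_union.1 ht with h | h
    · obtain ⟨i, hi, rfl⟩ := Finset.mem_image.1 h
      rw [Finset.mem_Icc] at hi
      refine ⟨⟨?_, ?_⟩, hqz i hi.1 hi.2⟩
      · rw [← θ0]; exact θmono.monotone (Nat.zero_le _)
      · rw [← θ1]; exact θmono (by omega)
    · obtain ⟨i, hi, rfl⟩ := Finset.mem_image.1 h
      rw [Finset.mem_Icc] at hi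
      have := hξ i hi.1 hi.2
      refine ⟨⟨?_, ?_⟩, this.2⟩
      · rw [← θ0]; exact (θmono.monotone (Nat.zero_le _)).trans this.1.1.le
      · rw [← θ1]; exact this.1.2.trans_le (θmono.monotone (by omega))
  have all : ∀ z ∈ Set.Ico (0:ℝ) 1, q z = 0 → z ∈ T₀ := by
    intro z hz1 hz2
    by_contra hz3
    have := count (insert z T₀) ∅ (by
      intro t ht
      rcases Finset.mem_insert.1 ht with rfl | h
      · exact ⟨hz1, hz2⟩
      · exact T₀z t h) (by simp) (by simp)
    rw [Finset.card_insert_of_notMem hz3, T₀card] at this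
    simp at this
  have simple : ∀ k : ℕ, 1 ≤ k → k ≤ n → r (θ k) ≠ 0 := by
    intro k h1 h2 h3
    have := count T₀ {θ k} T₀z (by
      rw [Finset.singleton_subset_iff]
      exact Finset.mem_union_left _ (Finset.mem_image_of_mem _ (by simp [h1, h2]))) (by simpa using h3)
    rw [T₀card] at this
    simp at this
  have uniq : ∀ k ≤ n, ∀ z ∈ Set.Ioo (θ k) (θ (k+1)), q z = 0 → 1 ≤ k ∧ z = ξ k := by
    intro k hk z hz1 hz2
    have hz3 : z ∈ Set.Ico (0:ℝ) 1 := by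
      refine ⟨?_, ?_⟩
      · rw [← θ0]; exact (θmono.monotone (Nat.zero_le _)).trans hz1.1.le
      · rw [← θ1]; exact hz1.2.trans_le (θmono.monotone (by omega))
    rcases Finset.mem_union.1 (all z hz3 hz2) with h | h
    · obtain ⟨i, hi, rfl⟩ := Finset.mem_image.1 h
      exact absurd hz1 (loc' k i)
    · obtain ⟨i, hi, rfl⟩ := Finset.mem_image.1 h
      rw [Finset.mem_Icc] at hi
      have := loc _ _ _ (hξ i hi.1 hi.2).1 hz1
      subst this
      exact ⟨hi.1, rfl⟩
  have nz : ∀ k ≤ n, ∀ w ∈ Set.Ioo (θ k) (θ (k+1)), g w ≠ 0 := by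
    intro k hk w hw hgw
    obtain ⟨z2, hz2, hq2⟩ := rolle w (θ (k+1)) hw.2 hgw
      (by have := hz (k+1) (by omega) (by omega); exact this)
    obtain ⟨hk1, e2⟩ := uniq k hk z2 ⟨hw.1.trans hz2.1, hz2.2⟩ hq2
    obtain ⟨z1, hz1, hq1⟩ := rolle (θ k) w hw.1 (hz k hk1 (by omega)) hgw
    obtain ⟨_, e1⟩ := uniq k hk z1 ⟨hz1.1, hz1.2.trans hw.2⟩ hq1
    have := hz1.2.trans hz2.1
    rw [e1, e2] at this
    exact lt_irrefl _ this
  have hderiv : deriv g = q := funext fun x => (hg x).deriv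
  have hderiv2 : ∀ x, deriv (deriv g) x = r x := fun x => by rw [hderiv]; exact (hq x).deriv
  have main : ∀ k : ℕ, k ≤ n → ∀ x ∈ Set.Icc (θ k) (θ (k+1)), 0 ≤ g x := by
    intro k
    induction k with
    | zero =>
      intro _ x hx
      by_contra! hneg
      have hx0 : θ 0 < x := lt_of_le_of_ne hx.1 (by rintro rfl; rw [θ0, h0] at hneg; linarith)
      have hx1 : x < θ (0+1) := lt_of_le_of_ne hx.2 (by
        rintro rfl
        have := hz 1 (by omega) (by omega)
        simp only [hθ] at hneg
        rw [zero_add, this] at hneg; linarith)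
      obtain ⟨w, hw, hgw⟩ := intermediate_value_Icc' hx.1 gcont.continuousOn
        (show (0:ℝ) ∈ Set.Icc (g x) (g (θ 0)) from ⟨hneg.le, by rw [θ0, h0]; norm_num⟩)
      have hw0 : θ 0 < w := lt_of_le_of_ne hw.1 (by rintro rfl; rw [θ0, h0] at hgw; linarith)
      exact nz 0 (by omega) w ⟨hw0, hw.2.trans_lt hx1⟩ hgw
    | succ k ih =>
      intro hk x hx
      have ih := ih (by omega)
      by_contra! hneg
      have gθ : g (θ (k+1)) = 0 := by
        have := hz (k+1) (by omega) (by omega); exact this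
      have gθ' : g (θ (k+1+1)) = 0 := by
        have := hz (k+1+1) (by omega) (by omega); exact this
      have qθ : q (θ (k+1)) = 0 := by
        have := hqz (k+1) (by omega) (by omega); exact this
      have hx0 : θ (k+1) < x := lt_of_le_of_ne hx.1 (by rintro rfl; linarith)
      have hx1 : x < θ (k+1+1) := lt_of_le_of_ne hx.2 (by rintro rfl; linarith)
      rcases lt_or_gt_of_ne (simple (k+1) (by omega) hk) with hr | hr
      · have hmax : IsLocalMax g (θ (k+1)) :=
          isLocalMax_of_deriv_deriv_neg (by rw [hderiv2]; exact hr) (by rw [hderiv]; exact qθ)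
            gcont.continuousAt
        have hev : ∀ᶠ y in nhdsWithin (θ (k+1)) (Set.Iio (θ (k+1))), g y ≤ g (θ (k+1)) :=
          hmax.filter_mono nhdsWithin_le_nhds
        have hev2 : ∀ᶠ y in nhdsWithin (θ (k+1)) (Set.Iio (θ (k+1))), y ∈ Set.Ioo (θ k) (θ (k+1)) :=
          Ioo_mem_nhdsLT (θmono (Nat.lt_succ_self k))
        obtain ⟨y, hy1, hy2⟩ := (hev.and hev2).exists
        exact nz k (by omega) y hy2
          (le_antisymm (by rw [← gθ]; exact hy1) (ih y ⟨hy2.1.le, hy2.2.le⟩))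
      · have hmin : IsLocalMin g (θ (k+1)) :=
          isLocalMin_of_deriv_deriv_pos (by rw [hderiv2]; exact hr) (by rw [hderiv]; exact qθ)
            gcont.continuousAt
        have hev : ∀ᶠ y in nhdsWithin (θ (k+1)) (Set.Ioi (θ (k+1))), g (θ (k+1)) ≤ g y :=
          hmin.filter_mono nhdsWithin_le_nhds
        have hev2 : ∀ᶠ y in nhdsWithin (θ (k+1)) (Set.Ioi (θ (k+1))), y ∈ Set.Ioo (θ (k+1)) x :=
          Ioo_mem_nhdsGT hx0
        obtain ⟨y, hy1, hy2⟩ := (hev.and hev2).exists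
        rw [gθ] at hy1
        obtain ⟨w, hw, hgw⟩ := intermediate_value_Icc' hy2.2.le gcont.continuousOn
          (show (0:ℝ) ∈ Set.Icc (g x) (g y) from ⟨hneg.le, hy1⟩)
        exact nz (k+1) hk w ⟨hy2.1.trans_le hw.1, hw.2.trans_lt hx1⟩ hgw
  intro x hx
  by_cases hx1 : x = 1
  · rw [hx1, ← θ1]; exact le_of_eq (by have := hz (n+1) (by omega) (by omega); exact this.symm)
  have hx2 : x < 1 := lt_of_le_of_ne hx.2 hx1
  have hxn : 0 ≤ x * (n+1) := mul_nonneg hx.1 hn1.le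
  have hf1 := Nat.floor_le hxn
  have hf2 := Nat.lt_floor_add_one (x * (n+1))
  refine main ⌊x * (n+1)⌋₊ ?_ x ⟨?_, ?_⟩
  · have : ⌊x * (n+1)⌋₊ < n + 1 := by
      rw [Nat.floor_lt hxn]; push_cast; nlinarith
    omega
  · simp only [hθ]; rw [div_le_iff₀ hn1]; exact hf1
  · simp only [hθ]; rw [le_div_iff₀ hn1]; push_cast; exact hf2.le

lemma theta_mem (n k : ℕ) (hk : k ≤ n) : (k / (n + 1) : ℝ) ∈ Set.Ico (0:ℝ) 1 := by
  refine ⟨by positivity, ?_⟩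
  rw [div_lt_one (by positivity)]
  have : (k : ℝ) ≤ n := by exact_mod_cast hk
  linarith

/-- Extension by zero of finitely many coefficients. -/
noncomputable def extc (n : ℕ) (a : {m : ℤ // m ∈ Finset.Icc (-(n:ℤ)) n} → ℂ) : ℤ → ℂ :=
  fun m => if h : m ∈ Finset.Icc (-(n:ℤ)) n then a ⟨m, h⟩ else 0

lemma extc_add (n : ℕ) (a b : {m : ℤ // m ∈ Finset.Icc (-(n:ℤ)) n} → ℂ) :
    extc n (a + b) = fun m => extc n a m + extc n b m := by
  funext m; unfold extc; split_ifs <;> simp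

lemma extc_smul (n : ℕ) (t : ℂ) (a : {m : ℤ // m ∈ Finset.Icc (-(n:ℤ)) n} → ℂ) :
    extc n (t • a) = fun m => t * extc n a m := by
  funext m; unfold extc; split_ifs <;> simp

lemma dc_add (c d : ℤ → ℂ) : dc (fun m => c m + d m) = fun m => dc c m + dc d m := by
  funext m; simp only [dc]; ring

lemma dc_smul (t : ℂ) (c : ℤ → ℂ) : dc (fun m => t * c m) = fun m => t * dc c m := by
  funext m; simp only [dc]; ring

/-- The Hermite interpolation map. -/
noncomputable def hermiteMap (n : ℕ) :
    ({m : ℤ // m ∈ Finset.Icc (-(n:ℤ)) n} → ℂ) →ₗ[ℂ] (Fin (n+1) ⊕ Fin n → ℂ) where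
  toFun a := Sum.elim (fun k => TP n (extc n a) ((k : ℕ) / (n + 1)))
    (fun k => TP n (dc (extc n a)) (((k : ℕ) + 1 : ℕ) / (n + 1)))
  map_add' a b := by
    funext i
    rcases i with i | i
    · simp only [Sum.elim_inl, Pi.add_apply, extc_add, TP_add]
    · simp only [Sum.elim_inr, Pi.add_apply, extc_add, dc_add, TP_add]
  map_smul' t a := by
    funext i
    rcases i with i | i
    · simp only [Sum.elim_inl, Pi.smul_apply, extc_smul, TP_smul, smul_eq_mul, RingHom.id_apply]
    · simp only [Sum.elim_inr, Pi.smul_apply, extc_smul, dc_smul, TP_smul, smul_eq_mul,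
        RingHom.id_apply]

lemma hermiteMap_injective (n : ℕ) : Function.Injective (hermiteMap n) := by
  classical
  rw [← LinearMap.ker_eq_bot, LinearMap.ker_eq_bot']
  intro a ha
  have hn1 : (0:ℝ) < n + 1 := by positivity
  have hinj : Function.Injective (fun k : ℕ => (k / (n + 1) : ℝ)) := by
    intro i j hij
    simp only at hij
    rw [div_left_inj' hn1.ne'] at hij
    exact_mod_cast hij
  have h1 : ∀ k : ℕ, k ≤ n → TP n (extc n a) (k / (n + 1)) = 0 := by
    intro k hk
    have := congrFun ha (Sum.inl ⟨k, by omega⟩)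
    exact this
  have h2 : ∀ k : ℕ, 1 ≤ k → k ≤ n → TP n (dc (extc n a)) (k / (n + 1)) = 0 := by
    intro k hk1 hk
    have := congrFun ha (Sum.inr ⟨k - 1, by omega⟩)
    simp only [hermiteMap, LinearMap.coe_mk, AddHom.coe_mk, Sum.elim_inr] at this
    rw [Nat.sub_add_cancel hk1] at this
    exact this
  have h3 := coeff_zero_of_zeros n (extc n a)
    ((Finset.range (n+1)).image (fun k : ℕ => (k / (n + 1) : ℝ)))
    ((Finset.Icc 1 n).image (fun k : ℕ => (k / (n + 1) : ℝ)))
    (by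
      intro t ht
      obtain ⟨k, hk, rfl⟩ := Finset.mem_image.1 ht
      rw [Finset.mem_range] at hk
      exact ⟨theta_mem n k (by omega), h1 k (by omega)⟩)
    (by
      apply Finset.image_subset_image
      intro k hk
      rw [Finset.mem_Icc] at hk
      rw [Finset.mem_range]; omega)
    (by
      intro t ht
      obtain ⟨k, hk, rfl⟩ := Finset.mem_image.1 ht
      rw [Finset.mem_Icc] at hk
      exact h2 k hk.1 hk.2)
    (by
      rw [Finset.card_image_of_injective _ hinj, Finset.card_image_of_injective _ hinj]
      simp; omega)
  funext m
  have := h3 m.1 m.2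
  unfold extc at this
  rw [dif_pos m.2] at this
  exact this

lemma hermiteMap_surjective (n : ℕ) : Function.Surjective (hermiteMap n) := by
  refine (LinearMap.injective_iff_surjective_of_finrank_eq_finrank ?_).1 (hermiteMap_injective n)
  rw [Module.finrank_fintype_fun_eq_card, Module.finrank_fintype_fun_eq_card]
  rw [Fintype.card_coe, Int.card_Icc]
  simp; omega

lemma exists_interp (n : ℕ) : ∃ c : ℤ → ℂ, TP n c 0 = ((1/2 : ℝ) : ℂ) ∧
    (∀ k : ℕ, 1 ≤ k → k ≤ n → TP n c (k / (n + 1)) = (((k / (n + 1) : ℝ) - 1/2 : ℝ) : ℂ)) ∧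
    (∀ k : ℕ, 1 ≤ k → k ≤ n → TP n (dc c) (k / (n + 1)) = 1) := by
  obtain ⟨a, ha⟩ := hermiteMap_surjective n
    (Sum.elim (fun k => if (k : ℕ) = 0 then ((1/2 : ℝ) : ℂ) else
      ((((k : ℕ) / (n + 1) : ℝ) - 1/2 : ℝ) : ℂ)) (fun _ => 1))
  refine ⟨extc n a, ?_, ?_, ?_⟩
  · have := congrFun ha (Sum.inl ⟨0, by omega⟩)
    simpa [hermiteMap] using this
  · intro k hk1 hk
    have := congrFun ha (Sum.inl ⟨k, by omega⟩)
    simp only [hermiteMap, LinearMap.coe_mk, AddHom.coe_mk, Sum.elim_inl] at this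
    rw [if_neg (by omega)] at this
    exact this
  · intro k hk1 hk
    have := congrFun ha (Sum.inr ⟨k - 1, by omega⟩)
    simp only [hermiteMap, LinearMap.coe_mk, AddHom.coe_mk, Sum.elim_inr] at this
    rw [Nat.sub_add_cancel hk1] at this
    exact this

lemma quadrature (n : ℕ) (c : ℤ → ℂ) :
    ∑ k ∈ Finset.range (n + 1), TP n c (k / (n + 1)) = (n + 1) * c 0 := by
  unfold TP
  rw [Finset.sum_comm]
  have hN : ((n : ℂ) + 1) ≠ 0 := by exact_mod_cast Nat.succ_ne_zero n
  rw [Finset.sum_eq_single 0]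
  · simp
  · intro m hm hm0
    rw [Finset.mem_Icc] at hm
    rw [← Finset.mul_sum]
    set ζ : ℂ := Complex.exp (2 * (Real.pi : ℂ) * Complex.I * ((m : ℂ) / (n + 1))) with hζ
    have h1 : ∀ k : ℕ, Complex.exp (2 * (Real.pi : ℂ) * Complex.I * (m : ℂ) *
        ((k / (n + 1) : ℝ) : ℂ)) = ζ ^ k := by
      intro k
      rw [hζ, ← Complex.exp_nat_mul]
      congr 1
      push_cast; ring
    simp only [h1]
    have h2 : ζ ^ (n + 1) = 1 := by
      rw [hζ, ← Complex.exp_nat_mul, Complex.exp_eq_one_iff]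
      refine ⟨m, ?_⟩
      push_cast; field_simp
    have h3 : ζ ≠ 1 := by
      intro h
      rw [hζ, Complex.exp_eq_one_iff] at h
      obtain ⟨j, hj⟩ := h
      have h4 : (2 * (Real.pi : ℂ) * Complex.I) * ((m : ℂ) / (n + 1) - j) = 0 := by
        linear_combination hj
      have h5 : (m : ℂ) / (n + 1) - j = 0 := by
        rcases mul_eq_zero.1 h4 with h | h
        · exact absurd h (by simp [Real.pi_ne_zero])
        · exact h
      have h6 : (m : ℂ) = j * (n + 1) := by
        field_simp at h5; linear_combination h5
      have h7 : m = j * (n + 1) := by exact_mod_cast h6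
      rcases lt_trichotomy j 0 with h | h | h
      · nlinarith
      · subst h; simp at h7; exact hm0 h7
      · nlinarith
    rw [geom_sum_eq h3, h2]; simp
  · intro h; simp at h

lemma exists_majorant (n : ℕ) : ∃ b : ℤ → ℂ, b 0 = ((1 / (2 * (n + 1)) : ℝ) : ℂ) ∧
    (∀ y ∈ Set.Icc (0:ℝ) 1, y - 1/2 ≤ (TP n b y).re) ∧ (∀ y, TP n b y = ((TP n b y).re : ℂ)) := by
  obtain ⟨c, hc0, hc1, hc2⟩ := exists_interp n
  have hn1 : (0:ℝ) < n + 1 := by positivity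
  refine ⟨rc c, ?_, ?_, ?_⟩
  · have hq := quadrature n (rc c)
    rw [Finset.sum_range_succ'] at hq
    have hs : ∀ k ∈ Finset.range n, TP n (rc c) (((k + 1 : ℕ) : ℝ) / (n + 1)) =
        (((((k + 1 : ℕ) : ℝ) / (n + 1)) - 1/2 : ℝ) : ℂ) := by
      intro k hk
      rw [Finset.mem_range] at hk
      rw [TP_re, hc1 (k+1) (by omega) (by omega), Complex.ofReal_re]
    rw [Finset.sum_congr rfl hs, TP_re] at hq
    simp only [Nat.cast_zero, zero_div] at hq
    rw [hc0, Complex.ofReal_re, ← Complex.ofReal_sum] at hq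
    have hsum : ∀ N : ℕ, ∑ k ∈ Finset.range N, (((k + 1 : ℕ) : ℝ) / (n + 1) - 1/2)
        = (N * (N + 1) / 2) / (n + 1) - N / 2 := by
      intro N
      induction N with
      | zero => simp
      | succ N ih => rw [Finset.sum_range_succ, ih]; push_cast; field_simp; ring
    rw [hsum] at hq
    have e : ((n:ℝ) * (n + 1) / 2) / (n + 1) - n / 2 = 0 := by field_simp; ring
    rw [e] at hq
    have hN : ((n : ℂ) + 1) ≠ 0 := by exact_mod_cast Nat.succ_ne_zero n
    have : rc c 0 = (1/2) / (n + 1) := by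
      field_simp
      push_cast at hq
      linear_combination -2 * hq
    rw [this]; push_cast; field_simp
  · intro y hy
    rw [TP_re, Complex.ofReal_re]
    set g : ℝ → ℝ := fun x => (TP n c x).re - x + 1/2 with hgdef
    set q : ℝ → ℝ := fun x => (TP n (dc c) x).re - 1 with hqdef
    set r : ℝ → ℝ := fun x => (TP n (dc (dc c)) x).re with hrdef
    have hg : ∀ x, HasDerivAt g (q x) x := fun x =>
      ((TP_re_hasDerivAt n c x).sub (hasDerivAt_id x)).add_const (1/2)
    have hq : ∀ x, HasDerivAt q (r x) x := fun x =>
      (TP_re_hasDerivAt n (dc c) x).sub_const 1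
    have g0 : g 0 = 1 := by simp only [hgdef, hc0, Complex.ofReal_re]; norm_num
    have g1 : g 1 = 0 := by
      have := TP_periodic n c 0
      rw [zero_add] at this
      simp only [hgdef, this, hc0, Complex.ofReal_re]; norm_num
    have key := nonneg_of_count n g q r hg hq g0
      (by
        intro k hk1 hk
        rcases Nat.lt_or_ge n k with h | h
        · have : k = n + 1 := by omega
          subst this
          have e : (((n + 1 : ℕ) : ℝ) / (n + 1)) = 1 := by push_cast; field_simp
          rw [e, g1]
        · simp only [hgdef, hc1 k hk1 h, Complex.ofReal_re]; ring)
      (by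
        intro k hk1 hk
        simp only [hqdef, hc2 k hk1 hk]; simp)
      (by
        intro T D hT hDT hD
        by_contra! hcard
        set a : ℤ → ℂ := fun m => rc (dc c) m + (if m = 0 then (-1:ℂ) else 0) with ha
        have hTa : ∀ x, TP n a x = (q x : ℂ) := by
          intro x
          rw [ha, TP_add, TP_const, TP_re, hqdef]; push_cast; ring
        have hTda : ∀ x, TP n (dc a) x = (r x : ℂ) := by
          intro x
          have h1 := TP_hasDerivAt n a x
          have h2 : HasDerivAt (fun x => (q x : ℂ)) (r x : ℂ) x := (hq x).ofReal_comp
          rw [show TP n a = fun x => (q x : ℂ) from funext hTa] at h1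
          exact h1.unique h2
        have hz := coeff_zero_of_zeros n a T D
          (fun t ht => ⟨(hT t ht).1, by rw [hTa, (hT t ht).2]; simp⟩) hDT
          (fun t ht => by rw [hTda, hD t ht]; simp) (by omega)
        have hq0 : ∀ x, q x = 0 := by
          intro x
          have h1 := hTa x
          rw [TP_congr n (d := fun _ => 0) hz] at h1
          simp only [TP, zero_mul, Finset.sum_const_zero] at h1
          exact_mod_cast h1.symm
        have := is_const_of_deriv_eq_zero (f := g) (fun x => (hg x).differentiableAt)
          (fun x => by rw [(hg x).deriv, hq0]) 0 1
        rw [g0, g1] at this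
        norm_num at this)
      y hy
    simp only [hgdef] at key
    linarith
  · intro y
    rw [TP_re, Complex.ofReal_re]

lemma exists_partition (S : Finset ℝ) (hS : ∀ x ∈ S, x ∈ Set.Icc (0:ℝ) 1) :
    ∃ (m : ℕ) (u : ℕ → ℝ), Monotone u ∧ (∀ i, u i ∈ Set.Icc (0:ℝ) 1) ∧ u 0 = 0 ∧ u m = 1 ∧
      ∀ x ∈ S, ∃ l ≤ m, u l = x := by
  classical
  set T : Finset ℝ := insert 0 (insert 1 S) with hT
  have hTI : ∀ x ∈ T, x ∈ Set.Icc (0:ℝ) 1 := by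
    intro x hx
    rw [hT, Finset.mem_insert, Finset.mem_insert] at hx
    rcases hx with rfl | rfl | h
    · simp
    · simp
    · exact hS x h
  obtain ⟨m, hm⟩ : ∃ m, T.card = m + 1 :=
    ⟨T.card - 1, by have : 0 < T.card := Finset.card_pos.2 ⟨0, by simp [hT]⟩
                    omega⟩
  set u : ℕ → ℝ := fun i => T.orderEmbOfFin hm ⟨min i m, by omega⟩ with hu
  have humono : Monotone u := by
    intro i j hij
    apply (T.orderEmbOfFin hm).monotone
    simp only [Fin.mk_le_mk]; omega
  have huT : ∀ i, u i ∈ T := fun i => Finset.orderEmbOfFin_mem _ _ _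
  have hex : ∀ x ∈ T, ∃ l ≤ m, u l = x := by
    intro x hx
    have : x ∈ Set.range (T.orderEmbOfFin hm) := by
      rw [Finset.range_orderEmbOfFin]; exact hx
    obtain ⟨i, hi⟩ := this
    refine ⟨i, by omega, ?_⟩
    rw [← hi, hu]
    simp only
    congr 1
    ext
    simp only; omega
  refine ⟨m, u, humono, fun i => hTI _ (huT i), ?_, ?_, fun x hx => hex x (by simp [hT, hx])⟩
  · obtain ⟨l, _, hl⟩ := hex 0 (by simp [hT])
    exact le_antisymm (hl ▸ humono (Nat.zero_le l)) (hTI _ (huT 0)).1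
  · obtain ⟨l, hlm, hl⟩ := hex 1 (by simp [hT])
    exact le_antisymm (hTI _ (huT m)).2 (by rw [← hl]; exact humono hlm)

lemma finite_stage (f : ℝ → ℝ) (V : ℝ) (hV0 : 0 ≤ V)
    (hV : eVariationOn f (Set.Icc 0 1) = ENNReal.ofReal V) (hf : f 1 = f 0) (n : ℕ)
    (b : ℤ → ℂ) (hb0 : b 0 = ((1 / (2 * (n + 1)) : ℝ) : ℂ))
    (hb1 : ∀ y ∈ Set.Icc (0:ℝ) 1, y - 1/2 ≤ (TP n b y).re)
    (S : Finset ℝ) (hS : ∀ x ∈ S, x ∈ Set.Icc (0:ℝ) 1) :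
    ∃ c d : ℤ → ℂ, (∀ m, ‖c m‖ ≤ |f 1| + V + V * (‖b (-m)‖ + ‖b m‖)) ∧
      (∀ m, ‖d m‖ ≤ |f 1| + V + V * (‖b (-m)‖ + ‖b m‖)) ∧
      (c 0 - d 0).re ≤ V / (n + 1) ∧
      ∀ x ∈ S, f x ≤ (TP n c x).re ∧ (TP n d x).re ≤ f x := by
  obtain ⟨m, u, humono, huI, hu0, hum, hux⟩ := exists_partition S hS
  set j : ℕ → ℝ := fun i => f (u (i+1)) - f (u i) with hj
  set p : ℕ → ℝ := fun i => max (j i) 0 with hp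
  set s : ℕ → ℝ := fun i => max (-j i) 0 with hs
  have hp0 : ∀ i, 0 ≤ p i := fun i => le_max_right _ _
  have hs0 : ∀ i, 0 ≤ s i := fun i => le_max_right _ _
  have hps : ∀ i, p i - s i = j i := by
    intro i; simp only [hp, hs]
    rcases le_total (j i) 0 with h | h
    · rw [max_eq_right h, max_eq_left (by linarith)]; ring
    · rw [max_eq_left h, max_eq_right (by linarith)]; ring
  have hpsa : ∀ i, p i + s i = |j i| := by
    intro i; simp only [hp, hs]
    rcases le_total (j i) 0 with h | h
    · rw [max_eq_right h, max_eq_left (by linarith), abs_of_nonpos h]; ring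
    · rw [max_eq_left h, max_eq_right (by linarith), abs_of_nonneg h]; ring
  have hsumV : ∑ i ∈ Finset.range m, |j i| ≤ V := by
    have h1 := eVariationOn.sum_le (f := f) (s := Set.Icc (0:ℝ) 1) (n := m) (u := u) humono huI
    rw [hV] at h1
    have h2 : ∑ i ∈ Finset.range m, edist (f (u (i + 1))) (f (u i)) =
        ENNReal.ofReal (∑ i ∈ Finset.range m, |j i|) := by
      rw [ENNReal.ofReal_sum_of_nonneg (fun i _ => abs_nonneg _)]
      refine Finset.sum_congr rfl fun i _ => ?_
      rw [edist_dist, Real.dist_eq]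
    rw [h2] at h1
    exact (ENNReal.ofReal_le_ofReal_iff hV0).1 h1
  have hpsV : ∑ i ∈ Finset.range m, (p i + s i) ≤ V := by
    rw [Finset.sum_congr rfl fun i _ => hpsa i]; exact hsumV
  have htel : ∀ l, ∑ i ∈ Finset.range l, j i = f (u l) - f 0 := by
    intro l
    rw [Finset.sum_range_sub (fun i => f (u i)), hu0]
  set C : ℝ := f 1 - ∑ i ∈ Finset.range m, j i * u (i+1) with hC
  have hCb : |C| ≤ |f 1| + V := by
    have h1 : |∑ i ∈ Finset.range m, j i * u (i+1)| ≤ V := by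
      refine (Finset.abs_sum_le_sum_abs _ _).trans (le_trans (Finset.sum_le_sum fun i _ => ?_) hsumV)
      rw [abs_mul, abs_of_nonneg (huI (i+1)).1]
      exact mul_le_of_le_one_right (abs_nonneg _) (huI (i+1)).2
    calc |C| ≤ |f 1| + |∑ i ∈ Finset.range m, j i * u (i+1)| := abs_sub _ _
      _ ≤ _ := by linarith
  set E : ℕ → ℤ → ℂ := fun i k =>
    Complex.exp (2 * (Real.pi : ℂ) * Complex.I * (k : ℂ) * ((-u (i+1) : ℝ) : ℂ)) with hE
  have hEn : ∀ i k, ‖E i k‖ = 1 := by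
    intro i k
    rw [hE]
    have : 2 * (Real.pi : ℂ) * Complex.I * (k : ℂ) * ((-u (i+1) : ℝ) : ℂ) =
      ((2 * Real.pi * k * (-u (i+1)) : ℝ) : ℂ) * Complex.I := by push_cast; ring
    simp only [this]
    exact Complex.norm_exp_ofReal_mul_I _
  -- general combination
  let F : (ℕ → ℝ) → (ℕ → ℝ) → ℤ → ℂ := fun v w k => (if k = 0 then (C:ℂ) else 0) +
    ∑ i ∈ Finset.range m, ((v i : ℂ) * (b (-k) * E i k) + (w i : ℂ) * (b k * E i k))
  have hFb : ∀ v w : ℕ → ℝ, (∀ i, |v i| + |w i| ≤ |j i|) → ∀ k,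
      ‖F v w k‖ ≤ |f 1| + V + V * (‖b (-k)‖ + ‖b k‖) := by
    intro v w hvw k
    refine (norm_add_le _ _).trans (add_le_add ?_ ?_)
    · split_ifs
      · rw [Complex.norm_real]; exact hCb
      · rw [norm_zero]; positivity
    · calc _ ≤ ∑ i ∈ Finset.range m, |j i| * (‖b (-k)‖ + ‖b k‖) := by
            refine norm_sum_le_of_le _ fun i _ => (norm_add_le _ _).trans ?_
            rw [norm_mul, norm_mul, norm_mul, norm_mul, hEn, Complex.norm_real, Complex.norm_real,
              Real.norm_eq_abs, Real.norm_eq_abs]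
            nlinarith [hvw i, abs_nonneg (v i), abs_nonneg (w i), norm_nonneg (b k),
              norm_nonneg (b (-k)), mul_nonneg (abs_nonneg (v i)) (norm_nonneg (b k)),
              mul_nonneg (abs_nonneg (w i)) (norm_nonneg (b (-k))),
              mul_le_mul_of_nonneg_right (hvw i) (add_nonneg (norm_nonneg (b (-k))) (norm_nonneg (b k)))]
        _ ≤ _ := by
            rw [← Finset.sum_mul]
            exact mul_le_mul_of_nonneg_right hsumV (by positivity)
  have hFT : ∀ v w : ℕ → ℝ, ∀ x, (TP n (F v w) x).re = C + ∑ i ∈ Finset.range m,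
      (v i * (TP n b (-(x - u (i+1)))).re + w i * (TP n b (x - u (i+1))).re) := by
    intro v w x
    have : TP n (F v w) x = (C : ℂ) + ∑ i ∈ Finset.range m,
      ((v i : ℂ) * TP n b (-(x - u (i+1))) + (w i : ℂ) * TP n b (x - u (i+1))) := by
      simp only [F]
      rw [TP_add, TP_const, TP_sum]
      congr 1
      refine Finset.sum_congr rfl fun i _ => ?_
      rw [TP_add, TP_smul, TP_smul, hE, TP_shift n (fun k => b (-k)), TP_shift, TP_neg]
      rfl
    rw [this]
    simp only [Complex.add_re, Complex.ofReal_re, Complex.re_sum, Complex.re_ofReal_mul]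
  have hF0 : ∀ v w : ℕ → ℝ, (F v w 0).re = C + ∑ i ∈ Finset.range m, (v i + w i) / (2 * (n + 1)) := by
    intro v w
    have hE0 : ∀ i, E i 0 = 1 := by intro i; simp [hE]
    have : F v w 0 = ((C + ∑ i ∈ Finset.range m, (v i + w i) / (2 * (n + 1)) : ℝ) : ℂ) := by
      simp only [F, hE0, neg_zero, hb0, if_true]
      push_cast
      congr 1
      refine Finset.sum_congr rfl fun i _ => ?_
      ring
    rw [this, Complex.ofReal_re]
  refine ⟨F p s, F (fun i => -s i) (fun i => -p i), hFb _ _ ?_, hFb _ _ ?_, ?_, ?_⟩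
  · intro i; rw [abs_of_nonneg (hp0 i), abs_of_nonneg (hs0 i), hpsa]
  · intro i; rw [abs_neg, abs_neg, abs_of_nonneg (hp0 i), abs_of_nonneg (hs0 i), ← hpsa, add_comm]
  · rw [Complex.sub_re, hF0, hF0]
    have : (C + ∑ i ∈ Finset.range m, (p i + s i) / (2 * ((n:ℝ) + 1))) -
        (C + ∑ i ∈ Finset.range m, (-s i + -p i) / (2 * ((n:ℝ) + 1))) =
        (∑ i ∈ Finset.range m, (p i + s i)) / (n + 1) := by
      rw [add_sub_add_left_eq_sub, ← Finset.sum_sub_distrib, Finset.sum_div]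
      refine Finset.sum_congr rfl fun i _ => ?_
      field_simp; ring
    rw [this]
    gcongr
  · intro x hx
    obtain ⟨l, hlm, rfl⟩ := hux x hx
    set ψ : ℕ → ℝ := fun i => u l - u (i+1) + 1/2 - (if i < l then 1 else 0) with hψ
    have hB1 : ∀ i, ψ i ≤ (TP n b (u l - u (i+1))).re := by
      intro i
      have h1 := huI l
      have h2 := huI (i+1)
      simp only [hψ]
      split_ifs with h
      · have := humono (show i + 1 ≤ l by omega)
        have := hb1 (u l - u (i+1)) ⟨by linarith, by linarith [h1.2, h2.1]⟩
        linarith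
      · have := humono (show l ≤ i + 1 by omega)
        have := hb1 (u l - u (i+1) + 1) ⟨by linarith [h1.1, h2.2], by linarith⟩
        rw [TP_periodic] at this
        linarith
    have hB2 : ∀ i, -ψ i ≤ (TP n b (-(u l - u (i+1)))).re := by
      intro i
      have h1 := huI l
      have h2 := huI (i+1)
      simp only [hψ]
      split_ifs with h
      · have := humono (show i + 1 ≤ l by omega)
        have := hb1 (-(u l - u (i+1)) + 1) ⟨by linarith [h1.2, h2.1], by linarith⟩
        rw [TP_periodic] at this
        linarith
      · have := humono (show l ≤ i + 1 by omega)
        have := hb1 (-(u l - u (i+1))) ⟨by linarith, by linarith [h1.1, h2.2]⟩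
        linarith
    have hsplit : ∑ i ∈ Finset.range m, j i * (if i < l then 1 else 0) = f (u l) - f 0 := by
      rw [← htel]
      simp only [mul_ite, mul_one, mul_zero]
      rw [← Finset.sum_filter]
      congr 1
      ext i; simp; omega
    have hid : f (u l) = C - ∑ i ∈ Finset.range m, j i * ψ i := by
      have : ∑ i ∈ Finset.range m, j i * ψ i = (u l + 1/2) * ∑ i ∈ Finset.range m, j i
          - ∑ i ∈ Finset.range m, j i * u (i+1)
          - ∑ i ∈ Finset.range m, j i * (if i < l then 1 else 0) := by
        rw [Finset.mul_sum, ← Finset.sum_sub_distrib, ← Finset.sum_sub_distrib]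
        refine Finset.sum_congr rfl fun i _ => ?_
        simp only [hψ]; ring
      rw [this, hsplit, htel, hum, hf, hC, hf]; ring
    rw [hFT, hFT, hid]
    constructor
    · rw [sub_eq_add_neg, ← Finset.sum_neg_distrib]
      gcongr with i _
      rw [← hps]
      nlinarith [mul_le_mul_of_nonneg_left (hB1 i) (hs0 i), mul_le_mul_of_nonneg_left (hB2 i) (hp0 i)]
    · rw [sub_eq_add_neg, ← Finset.sum_neg_distrib]
      gcongr with i _
      rw [← hps]
      nlinarith [mul_le_mul_of_nonneg_left (hB1 i) (hp0 i), mul_le_mul_of_nonneg_left (hB2 i) (hs0 i)]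

lemma TP_continuous (n : ℕ) (c : ℤ → ℂ) : Continuous (fun x => (TP n c x).re) :=
  continuous_iff_continuousAt.2 fun x => (TP_re_hasDerivAt n c x).continuousAt

lemma TP_integral (n : ℕ) (c : ℤ → ℂ) : ∫ x in (0:ℝ)..1, (TP n c x).re = (c 0).re := by
  set a : ℤ → ℂ := fun m => if m = 0 then 0 else c m / (2 * (Real.pi : ℂ) * Complex.I * (m : ℂ)) with ha
  have h1 : ∀ x, (TP n c x).re = (c 0).re + (TP n (dc a) x).re := by
    intro x
    rw [← Complex.add_re]
    congr 1
    conv_rhs => rw [← TP_const n (c 0) x, ← TP_add]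
    refine congrFun (TP_congr n fun m _ => ?_) x
    simp only [ha, dc]
    split_ifs with h
    · subst h; simp
    · have : (m : ℂ) ≠ 0 := by exact_mod_cast h
      have h2 : (Real.pi : ℂ) ≠ 0 := by exact_mod_cast Real.pi_ne_zero
      have h3 := Complex.I_ne_zero
      field_simp; simp
  have h2 : ∫ x in (0:ℝ)..1, (TP n (dc a) x).re = 0 := by
    rw [intervalIntegral.integral_eq_sub_of_hasDerivAt (fun x _ => TP_re_hasDerivAt n a x)
      ((TP_continuous n (dc a)).intervalIntegrable _ _)]
    have := TP_periodic n a 0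
    rw [zero_add] at this
    rw [this, sub_self]
  rw [intervalIntegral.integral_congr fun x _ => h1 x, intervalIntegral.integral_add
    (by simp) ((TP_continuous n (dc a)).intervalIntegrable _ _), h2]
  simp

lemma exists_coeffs (f : ℝ → ℝ) (V : ℝ) (hV0 : 0 ≤ V)
    (hV : eVariationOn f (Set.Icc 0 1) = ENNReal.ofReal V) (hf : f 1 = f 0) (n : ℕ) :
    ∃ c d : ℤ → ℂ, (c 0 - d 0).re ≤ V / (n + 1) ∧
      ∀ x ∈ Set.Icc (0:ℝ) 1, f x ≤ (TP n c x).re ∧ (TP n d x).re ≤ f x := by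
  obtain ⟨b, hb0, hb1, -⟩ := exists_majorant n
  set M : ℤ → ℝ := fun m => |f 1| + V + V * (‖b (-m)‖ + ‖b m‖) with hM
  set K : Set (ℤ → ℂ) := Set.univ.pi fun m => Metric.closedBall 0 (M m) with hK
  have hKc : IsCompact K := isCompact_univ_pi fun m => isCompact_closedBall _ _
  have hcl : IsClosed {z : (ℤ → ℂ) × (ℤ → ℂ) | (z.1 0 - z.2 0).re ≤ V / (n + 1)} :=
    isClosed_le (by fun_prop) continuous_const
  have hs := (hKc.prod hKc).inter_right hcl
  have hTPc : ∀ x, Continuous fun c : ℤ → ℂ => (TP n c x).re := by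
    intro x; unfold TP; fun_prop
  obtain ⟨⟨c, d⟩, h1, h2⟩ := hs.inter_iInter_nonempty
    (fun x : Set.Icc (0:ℝ) 1 => {z : (ℤ → ℂ) × (ℤ → ℂ) |
      f x ≤ (TP n z.1 x).re ∧ (TP n z.2 x).re ≤ f x})
    (fun x => (isClosed_le continuous_const ((hTPc x).comp continuous_fst)).inter
      (isClosed_le ((hTPc x).comp continuous_snd) continuous_const))
    (by
      intro S
      classical
      obtain ⟨c, d, hc, hd, h0, hx⟩ := finite_stage f V hV0 hV hf n b hb0 hb1
        (S.image Subtype.val) (by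
          intro x hx
          obtain ⟨y, _, rfl⟩ := Finset.mem_image.1 hx
          exact y.2)
      refine ⟨(c, d), ⟨⟨?_, ?_⟩, h0⟩, ?_⟩
      · intro m _; simpa using hc m
      · intro m _; simpa using hd m
      · simp only [Set.mem_iInter]
        intro x hxS
        exact hx x (Finset.mem_image_of_mem _ hxS))
  refine ⟨c, d, h1.2, fun x hx => ?_⟩
  exact Set.mem_iInter.1 h2 ⟨x, hx⟩

/-- Vaaler/Beurling–Selberg approximation: for a function `f` on `ℝ/ℤ` of bounded
variation `V` and every positive integer `κ`, there exist trigonometric polynomials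
`P⁻ ≤ f ≤ P⁺` of degree at most `κ` with `∫ (P⁺ − P⁻) = V/(κ+1)`; in particular
`‖P^±‖₁ ≤ ‖f‖₁ + V/(κ+1)`. -/
theorem stmt_10 (f : ℝ → ℝ) (hper : Function.Periodic f 1) (V : ℝ) (hV0 : 0 ≤ V)
    (hV : eVariationOn f (Set.Icc 0 1) = ENNReal.ofReal V)
    (κ : ℕ) (hκ : 0 < κ) :
    ∃ Pm Pp : ℝ → ℝ, IsTrigPolyDeg κ Pm ∧ IsTrigPolyDeg κ Pp ∧
      (∀ x : ℝ, Pm x ≤ f x) ∧ (∀ x : ℝ, f x ≤ Pp x) ∧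
      (∫ x in (0:ℝ)..1, (Pp x - Pm x)) = V / (κ + 1) ∧
      (∫ x in (0:ℝ)..1, |Pp x|) ≤ (∫ x in (0:ℝ)..1, |f x|) + V / (κ + 1) ∧
      (∫ x in (0:ℝ)..1, |Pm x|) ≤ (∫ x in (0:ℝ)..1, |f x|) + V / (κ + 1) := by
  have hf : f 1 = f 0 := by have := hper 0; rwa [zero_add] at this
  obtain ⟨c, d, h0, hx⟩ := exists_coeffs f V hV0 hV hf κ
  set δ : ℝ := V / (κ + 1) - (c 0 - d 0).re with hδ
  have hδ0 : 0 ≤ δ := by linarith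
  have hfper : ∀ x, f x = f (Int.fract x) := by
    intro x
    have := hper.sub_int_mul_eq (x := x) ⌊x⌋
    rw [mul_one, Int.self_sub_floor] at this
    exact this.symm
  have hTper : ∀ (c : ℤ → ℂ) x, TP κ c x = TP κ c (Int.fract x) := by
    intro c x
    have hp : Function.Periodic (TP κ c) 1 := fun x => TP_periodic κ c x
    have := hp.sub_int_mul_eq (x := x) ⌊x⌋
    rw [mul_one, Int.self_sub_floor] at this
    exact this.symm
  have hfr : ∀ x : ℝ, Int.fract x ∈ Set.Icc (0:ℝ) 1 := fun x =>
    ⟨Int.fract_nonneg x, (Int.fract_lt_one x).le⟩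
  have hm : ∀ x, (TP κ d x).re ≤ f x := by
    intro x; rw [hfper, hTper]; exact (hx _ (hfr x)).2
  have hp : ∀ x, f x ≤ (TP κ c x).re + δ := by
    intro x; rw [hfper, hTper]; linarith [(hx _ (hfr x)).1]
  have ic : IntervalIntegrable (fun x => (TP κ c x).re + δ) volume 0 1 :=
    ((TP_continuous κ c).add continuous_const).intervalIntegrable _ _
  have idd : IntervalIntegrable (fun x => (TP κ d x).re) volume 0 1 :=
    (TP_continuous κ d).intervalIntegrable _ _
  have hPint : (∫ x in (0:ℝ)..1, (((TP κ c x).re + δ) - (TP κ d x).re)) = V / (κ + 1) := by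
    rw [intervalIntegral.integral_sub ic idd, intervalIntegral.integral_add
      ((TP_continuous κ c).intervalIntegrable _ _) (by simp), TP_integral, TP_integral]
    simp [hδ]; ring
  have hfint : IntervalIntegrable f volume 0 1 := by
    have hbv : BoundedVariationOn f (Set.Icc 0 1) := by
      rw [BoundedVariationOn, hV]; exact ENNReal.ofReal_ne_top
    obtain ⟨p, q, hp, hq, hpq, -⟩ :=
      hbv.locallyBoundedVariationOn.exists_monotoneOn_sub_monotoneOn'
    rw [hpq]
    have e : Set.uIcc (0:ℝ) 1 = Set.Icc 0 1 := Set.uIcc_of_le zero_le_one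
    exact (MonotoneOn.intervalIntegrable (by rwa [e])).sub
      (MonotoneOn.intervalIntegrable (by rwa [e]))
  have hL : ∀ P : ℝ → ℝ, Continuous P →
      (∀ x, |P x| ≤ |f x| + (((TP κ c x).re + δ) - (TP κ d x).re)) →
      (∫ x in (0:ℝ)..1, |P x|) ≤ (∫ x in (0:ℝ)..1, |f x|) + V / (κ + 1) := by
    intro P hP hle
    rw [← hPint, ← intervalIntegral.integral_add hfint.abs (ic.sub idd)]
    exact intervalIntegral.integral_mono_on zero_le_one (hP.abs.intervalIntegrable _ _)
      (hfint.abs.add (ic.sub idd)) (fun x _ => hle x)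
  refine ⟨fun x => (TP κ d x).re, fun x => (TP κ c x).re + δ, ⟨rc d, fun x => ?_⟩,
    ⟨fun m => rc c m + if m = 0 then (δ:ℂ) else 0, fun x => ?_⟩, hm, hp, hPint, ?_, ?_⟩
  · rw [← TP_re]; rfl
  · change _ = TP κ (fun m => rc c m + if m = 0 then (δ:ℂ) else 0) x
    rw [TP_add, TP_const, TP_re]; push_cast; rfl
  · refine hL _ ((TP_continuous κ c).add continuous_const) fun x => ?_
    have h1 := hm x
    have h2 := hp x
    have h3 := abs_sub_abs_le_abs_sub ((TP κ c x).re + δ) (f x)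
    rw [abs_of_nonneg (by linarith : 0 ≤ (TP κ c x).re + δ - f x)] at h3
    linarith
  · refine hL _ (TP_continuous κ d) fun x => ?_
    have h1 := hm x
    have h2 := hp x
    have h3 := abs_sub_abs_le_abs_sub ((TP κ d x).re) (f x)
    rw [abs_sub_comm, abs_of_nonneg (by linarith : 0 ≤ f x - (TP κ d x).re)] at h3
    linarith
end

section
/- For the characteristic function 1_I of an interval I ⊆ ℝ/ℤ and any positive integer κ, there exist trigonometric polynomials P⁻ ≤ 1_I ≤ P⁺ of degree ≤ κ with ∫(P⁺ − P⁻) ≤ 2/(κ+1). -/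
open MeasureTheory

namespace Vaaler

/-! ### Closure properties of trigonometric polynomials -/

lemma tp_add {κ : ℕ} {P Q : ℝ → ℝ} (hP : IsTrigPolyDeg κ P) (hQ : IsTrigPolyDeg κ Q) :
    IsTrigPolyDeg κ (fun x => P x + Q x) := by
  obtain ⟨c, hc⟩ := hP
  obtain ⟨d, hd⟩ := hQ
  refine ⟨fun n => c n + d n, fun x => ?_⟩
  rw [Complex.ofReal_add, hc, hd, ← Finset.sum_add_distrib]
  exact Finset.sum_congr rfl fun n _ => by ring

lemma tp_smul {κ : ℕ} {P : ℝ → ℝ} (a : ℝ) (hP : IsTrigPolyDeg κ P) :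
    IsTrigPolyDeg κ (fun x => a * P x) := by
  obtain ⟨c, hc⟩ := hP
  refine ⟨fun n => a * c n, fun x => ?_⟩
  rw [Complex.ofReal_mul, hc, Finset.mul_sum]
  exact Finset.sum_congr rfl fun n _ => by ring

lemma tp_zero {κ : ℕ} : IsTrigPolyDeg κ (fun _ => 0) :=
  ⟨fun _ => 0, fun x => by simp⟩

lemma tp_sum {κ : ℕ} {ι : Type*} (s : Finset ι) (P : ι → ℝ → ℝ)
    (h : ∀ i ∈ s, IsTrigPolyDeg κ (P i)) : IsTrigPolyDeg κ (fun x => ∑ i ∈ s, P i x) := by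
  classical
  induction s using Finset.induction_on with
  | empty => simpa using tp_zero
  | insert i s hi ih =>
    simp only [Finset.sum_insert hi]
    exact tp_add (h i (Finset.mem_insert_self _ _))
      (ih fun j hj => h j (Finset.mem_insert_of_mem hj))

lemma tp_shift {κ : ℕ} {P : ℝ → ℝ} (a : ℝ) (hP : IsTrigPolyDeg κ P) :
    IsTrigPolyDeg κ (fun x => P (x - a)) := by
  obtain ⟨c, hc⟩ := hP
  refine ⟨fun n => c n * Complex.exp (2 * (Real.pi : ℂ) * Complex.I * (n : ℂ) * (-a : ℂ)),
    fun x => ?_⟩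
  rw [hc]
  refine Finset.sum_congr rfl fun n _ => ?_
  show _ = c n * _ * _
  rw [mul_assoc (c n), ← Complex.exp_add]
  congr 2
  push_cast
  ring

lemma tp_cos {κ : ℕ} (m : ℤ) (h1 : -(κ : ℤ) ≤ m) (h2 : m ≤ κ) :
    IsTrigPolyDeg κ (fun x => Real.cos (m * (2 * Real.pi * x))) := by
  refine ⟨fun n => (if n = m then 1 / 2 else 0) + (if n = -m then 1 / 2 else 0), fun x => ?_⟩
  simp only [add_mul, ite_mul, zero_mul, Finset.sum_add_distrib, Finset.sum_ite_eq',
    Finset.mem_Icc]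
  rw [if_pos ⟨h1, h2⟩, if_pos ⟨by omega, by omega⟩, Complex.ofReal_cos, Complex.cos]
  push_cast
  ring_nf

lemma tp_sin {κ : ℕ} (m : ℤ) (h1 : -(κ : ℤ) ≤ m) (h2 : m ≤ κ) :
    IsTrigPolyDeg κ (fun x => Real.sin (m * (2 * Real.pi * x))) := by
  refine ⟨fun n => (if n = m then -Complex.I / 2 else 0) +
    (if n = -m then Complex.I / 2 else 0), fun x => ?_⟩
  simp only [add_mul, ite_mul, zero_mul, Finset.sum_add_distrib, Finset.sum_ite_eq',
    Finset.mem_Icc]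
  rw [if_pos ⟨h1, h2⟩, if_pos ⟨by omega, by omega⟩, Complex.ofReal_sin, Complex.sin]
  push_cast
  ring_nf

lemma tp_const {κ : ℕ} (a : ℝ) : IsTrigPolyDeg κ (fun _ => a) := by
  have := tp_smul (κ := κ) a (tp_cos (κ := κ) 0 (by omega) (by omega))
  simpa using this

lemma tp_sincos {κ : ℕ} (m : ℤ) (h1 : -(κ : ℤ) < m) (h2 : m < κ) :
    IsTrigPolyDeg κ (fun x => Real.sin (2 * Real.pi * x) * Real.cos (m * (2 * Real.pi * x))) := by
  have h := tp_smul (1 / 2) (tp_add (tp_sin (κ := κ) (m + 1) (by omega) (by omega))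
    (tp_smul (-1) (tp_sin (κ := κ) (m - 1) (by omega) (by omega))))
  convert h using 2 with x
  push_cast
  rw [add_mul, sub_mul, one_mul, Real.sin_add, Real.sin_sub]
  ring

/-! ### The kernels -/

/-- The weighted Fejér kernel. -/
noncomputable def S (κ : ℕ) (r θ : ℝ) : ℝ :=
  ∑ j ∈ Finset.range (κ + 1), ∑ k ∈ Finset.range (κ + 1),
    r ^ (j + k) * Real.cos ((((j : ℤ) - (k : ℤ) : ℤ) : ℝ) * θ)

/-- coefficient functions -/
noncomputable def co (κ j k : ℕ) (r : ℝ) : ℝ :=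
  (r ^ (j + k) + r ^ ((κ - j) + (κ - k)) - 2 * r ^ κ) / (2 * (1 - r ^ (κ + 1)) ^ 2)

lemma geom_trig (r θ : ℝ) (N : ℕ) :
    (∑ k ∈ Finset.range N, r ^ k * Real.cos (k * θ)) * (1 - r * Real.cos θ)
      + (∑ k ∈ Finset.range N, r ^ k * Real.sin (k * θ)) * (r * Real.sin θ)
      = 1 - r ^ N * Real.cos (N * θ) ∧
    (∑ k ∈ Finset.range N, r ^ k * Real.sin (k * θ)) * (1 - r * Real.cos θ)
      - (∑ k ∈ Finset.range N, r ^ k * Real.cos (k * θ)) * (r * Real.sin θ)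
      = - (r ^ N * Real.sin (N * θ)) := by
  induction N with
  | zero => simp
  | succ n ih =>
    obtain ⟨h1, h2⟩ := ih
    rw [Finset.sum_range_succ, Finset.sum_range_succ]
    push_cast
    rw [add_mul (n : ℝ) 1 θ, one_mul, Real.cos_add, Real.sin_add, pow_succ]
    constructor
    · linear_combination h1
    · linear_combination h2

lemma S_eq_sq (κ : ℕ) (r θ : ℝ) :
    S κ r θ = (∑ k ∈ Finset.range (κ + 1), r ^ k * Real.cos (k * θ)) ^ 2
      + (∑ k ∈ Finset.range (κ + 1), r ^ k * Real.sin (k * θ)) ^ 2 := by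
  rw [sq, sq, Finset.sum_mul_sum, Finset.sum_mul_sum, ← Finset.sum_add_distrib, S]
  refine Finset.sum_congr rfl fun j _ => ?_
  rw [← Finset.sum_add_distrib]
  refine Finset.sum_congr rfl fun k _ => ?_
  push_cast
  rw [sub_mul, Real.cos_sub, pow_add]
  ring

lemma S_nonneg (κ : ℕ) (r θ : ℝ) : 0 ≤ S κ r θ := by
  rw [S_eq_sq]; positivity

lemma S_closed (κ : ℕ) (r θ : ℝ) :
    S κ r θ * (1 - 2 * r * Real.cos θ + r ^ 2)
      = 1 - 2 * r ^ (κ + 1) * Real.cos ((κ + 1 : ℕ) * θ) + (r ^ (κ + 1)) ^ 2 := by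
  obtain ⟨h1, h2⟩ := geom_trig r θ (κ + 1)
  rw [S_eq_sq]
  set C := ∑ k ∈ Finset.range (κ + 1), r ^ k * Real.cos (k * θ)
  set D := ∑ k ∈ Finset.range (κ + 1), r ^ k * Real.sin (k * θ)
  have e1 := Real.sin_sq_add_cos_sq θ
  have e2 := Real.sin_sq_add_cos_sq ((κ + 1 : ℕ) * θ)
  have h3 := congrArg (· ^ 2) h1
  have h4 := congrArg (· ^ 2) h2
  linear_combination h3 + h4 + (r ^ (κ + 1)) ^ 2 * e2 - (C ^ 2 + D ^ 2) * r ^ 2 * e1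

lemma S_reflect (κ : ℕ) (r θ : ℝ) :
    ∑ j ∈ Finset.range (κ + 1), ∑ k ∈ Finset.range (κ + 1),
      r ^ ((κ - j) + (κ - k)) * Real.cos ((((j : ℤ) - (k : ℤ) : ℤ) : ℝ) * θ) = S κ r θ := by
  rw [S, ← Finset.sum_range_reflect]
  refine Finset.sum_congr rfl fun j hj => ?_
  rw [← Finset.sum_range_reflect]
  refine Finset.sum_congr rfl fun k hk => ?_
  rw [Finset.mem_range] at hj hk
  have a1 : κ - (κ + 1 - 1 - j) = j := by omega
  have a2 : κ - (κ + 1 - 1 - k) = k := by omega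
  rw [a1, a2]
  have a3 : (((κ + 1 - 1 - j : ℕ) : ℤ) - ((κ + 1 - 1 - k : ℕ) : ℤ)) = -((j : ℤ) - (k : ℤ)) := by
    omega
  rw [a3, Int.cast_neg, neg_mul, Real.cos_neg]

lemma co_sum (κ : ℕ) (r θ : ℝ) :
    ∑ j ∈ Finset.range (κ + 1), ∑ k ∈ Finset.range (κ + 1),
      co κ j k r * Real.cos ((((j : ℤ) - (k : ℤ) : ℤ) : ℝ) * θ)
      = (S κ r θ - r ^ κ * S κ 1 θ) / (1 - r ^ (κ + 1)) ^ 2 := by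
  have h : (S κ r θ - r ^ κ * S κ 1 θ) / (1 - r ^ (κ + 1)) ^ 2
      = (S κ r θ + S κ r θ - 2 * r ^ κ * S κ 1 θ) / (2 * (1 - r ^ (κ + 1)) ^ 2) := by
    rw [show S κ r θ + S κ r θ - 2 * r ^ κ * S κ 1 θ = 2 * (S κ r θ - r ^ κ * S κ 1 θ) by ring,
      mul_div_mul_left _ _ two_ne_zero]
  rw [h]
  nth_rewrite 2 [← S_reflect]
  simp only [S, Finset.mul_sum, ← Finset.sum_add_distrib, ← Finset.sum_sub_distrib,
    Finset.sum_div, co]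
  refine Finset.sum_congr rfl fun j _ => Finset.sum_congr rfl fun k _ => ?_
  rw [one_pow]
  ring

lemma pow_aux {r : ℝ} (h0 : 0 ≤ r) (h1 : r ≤ 1) {κ s t : ℕ} (h : s + t = 2 * κ) (hst : s ≤ t) :
    0 ≤ r ^ s + r ^ t - 2 * r ^ κ ∧ r ^ s + r ^ t - 2 * r ^ κ ≤ (1 - r ^ (κ + 1)) ^ 2 := by
  obtain ⟨d, rfl⟩ : ∃ d, κ = s + d := ⟨κ - s, by omega⟩
  have ht : t = s + d + d := by omega
  subst ht
  have e : r ^ s + r ^ (s + d + d) - 2 * r ^ (s + d) = r ^ s * (1 - r ^ d) ^ 2 := by ring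
  rw [e]
  refine ⟨by positivity, ?_⟩
  have b1 : r ^ s ≤ 1 := pow_le_one₀ h0 h1
  have b2 : r ^ d ≤ 1 := pow_le_one₀ h0 h1
  have b3 : r ^ (s + d + 1) ≤ r ^ d := pow_le_pow_of_le_one h0 h1 (by omega)
  calc r ^ s * (1 - r ^ d) ^ 2 ≤ 1 * (1 - r ^ d) ^ 2 := by gcongr
    _ = (1 - r ^ d) ^ 2 := one_mul _
    _ ≤ (1 - r ^ (s + d + 1)) ^ 2 := by
      apply pow_le_pow_left₀ (by linarith); linarith

lemma co_bound {κ j k : ℕ} (hj : j ≤ κ) (hk : k ≤ κ) {r : ℝ} (h0 : 0 ≤ r) (h1 : r ≤ 1) :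
    0 ≤ co κ j k r ∧ co κ j k r ≤ 1 := by
  have key : 0 ≤ r ^ (j + k) + r ^ ((κ - j) + (κ - k)) - 2 * r ^ κ ∧
      r ^ (j + k) + r ^ ((κ - j) + (κ - k)) - 2 * r ^ κ ≤ (1 - r ^ (κ + 1)) ^ 2 := by
    rcases le_total (j + k) ((κ - j) + (κ - k)) with h | h
    · exact pow_aux h0 h1 (by omega) h
    · rw [add_comm (r ^ (j + k))]
      exact pow_aux h0 h1 (by omega) h
  refine ⟨div_nonneg key.1 (by positivity), div_le_one_of_le₀ ?_ (by positivity)⟩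
  nlinarith [key.2, sq_nonneg (1 - r ^ (κ + 1))]

lemma co_zero {κ j k : ℕ} (hj : j ≤ κ) (hk : k ≤ κ) (h : j + k = κ) (r : ℝ) :
    co κ j k r = 0 := by
  have : (κ - j) + (κ - k) = κ := by omega
  rw [co, this, h]
  ring

lemma co_integrable {κ j k : ℕ} (hj : j ≤ κ) (hk : k ≤ κ) :
    IntervalIntegrable (co κ j k) volume 0 1 := by
  rw [intervalIntegrable_iff_integrableOn_Ioc_of_le zero_le_one]
  refine Measure.integrableOn_of_bounded (M := 1) (by simp) ?_ ?_
  · apply Measurable.aestronglyMeasurable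
    unfold co
    fun_prop
  · rw [ae_restrict_iff' measurableSet_Ioc]
    refine Filter.Eventually.of_forall fun r hr => ?_
    obtain ⟨a, b⟩ := co_bound hj hk hr.1.le hr.2
    rw [Real.norm_eq_abs, abs_of_nonneg a]
    exact b

lemma S_zero_one (κ : ℕ) : S κ 1 0 = ((κ : ℝ) + 1) ^ 2 := by
  rw [S_eq_sq]; simp

lemma amgm (κ : ℕ) {r : ℝ} (h0 : 0 ≤ r) (h1 : r < 1) :
    r ^ κ * (1 - r) ^ 2 * ((κ : ℝ) + 1) ^ 2 ≤ (1 - r ^ (κ + 1)) ^ 2 := by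
  have hp : r ^ (κ + 1) < 1 := pow_lt_one₀ h0 h1 (by omega)
  have hpos : 0 < (1 - r ^ (κ + 1)) ^ 2 := by
    have : 0 < 1 - r ^ (κ + 1) := by linarith
    positivity
  have h := co_sum κ r 0
  have h2 : 0 ≤ (S κ r 0 - r ^ κ * S κ 1 0) / (1 - r ^ (κ + 1)) ^ 2 := by
    rw [← h]
    refine Finset.sum_nonneg fun j hj => Finset.sum_nonneg fun k hk => ?_
    rw [mul_zero, Real.cos_zero, mul_one]
    rw [Finset.mem_range] at hj hk
    exact (co_bound (by omega) (by omega) h0 h1.le).1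
  have h3 : 0 ≤ S κ r 0 - r ^ κ * S κ 1 0 := by
    by_contra hc
    push Not at hc
    exact absurd h2 (not_le.mpr (div_neg_of_neg_of_pos hc hpos))
  have h4 := S_closed κ r 0
  rw [mul_zero, Real.cos_zero] at h4
  rw [S_zero_one] at h3
  nlinarith [mul_nonneg h3 (sq_nonneg (1 - r))]

/-- The Poisson-type integrand. -/
noncomputable def q (θ r : ℝ) : ℝ := Real.sin θ / (1 - 2 * r * Real.cos θ + r ^ 2)

/-- The interpolant of the integrand. -/
noncomputable def T (κ : ℕ) (θ r : ℝ) : ℝ :=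
  ∑ j ∈ Finset.range (κ + 1), ∑ k ∈ Finset.range (κ + 1),
    co κ j k r * (Real.sin θ * Real.cos ((((j : ℤ) - (k : ℤ) : ℤ) : ℝ) * θ))

lemma T_eq (κ : ℕ) (θ r : ℝ) :
    T κ θ r = Real.sin θ * ((S κ r θ - r ^ κ * S κ 1 θ) / (1 - r ^ (κ + 1)) ^ 2) := by
  rw [← co_sum, T, Finset.mul_sum]
  refine Finset.sum_congr rfl fun j _ => ?_
  rw [Finset.mul_sum]
  exact Finset.sum_congr rfl fun k _ => by ring

lemma den_pos {θ : ℝ} (hs : 0 < Real.sin θ) (r : ℝ) : 0 < 1 - 2 * r * Real.cos θ + r ^ 2 := by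
  have e := Real.sin_sq_add_cos_sq θ
  nlinarith [sq_nonneg (r - Real.cos θ), mul_pos hs hs]

lemma T_bound (κ : ℕ) {θ r : ℝ} (hs : 0 < Real.sin θ) (h0 : 0 ≤ r) (h1 : r < 1) :
    0 ≤ q θ r - T κ θ r ∧ q θ r - T κ θ r ≤ q θ r * (S κ 1 θ / ((κ : ℝ) + 1) ^ 2) := by
  have hp : r ^ (κ + 1) < 1 := pow_lt_one₀ h0 h1 (by omega)
  have hpos : 0 < (1 - r ^ (κ + 1)) ^ 2 := by
    have : 0 < 1 - r ^ (κ + 1) := by linarith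
    positivity
  have hd := den_pos hs r
  have hS := S_nonneg κ 1 θ
  have c1 := S_closed κ r θ
  have c2 := S_closed κ 1 θ
  simp only [one_pow] at c2
  have e : q θ r - T κ θ r
      = q θ r * (S κ 1 θ * (r ^ κ * (1 - r) ^ 2 / (1 - r ^ (κ + 1)) ^ 2)) := by
    rw [T_eq, q]
    obtain ⟨E, hE⟩ : ∃ E, E = (1 - r ^ (κ + 1)) ^ 2 := ⟨_, rfl⟩
    obtain ⟨d, hdd⟩ : ∃ d, d = 1 - 2 * r * Real.cos θ + r ^ 2 := ⟨_, rfl⟩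
    rw [← hE] at hpos
    rw [← hdd] at hd
    rw [← hE, ← hdd]
    field_simp
    rw [hE, hdd]
    linear_combination -c1 + r ^ (κ + 1) * c2
  have hq : 0 < q θ r := div_pos hs hd
  rw [e]
  refine ⟨by positivity, ?_⟩
  apply mul_le_mul_of_nonneg_left _ hq.le
  rw [div_eq_mul_inv (S κ 1 θ)]
  apply mul_le_mul_of_nonneg_left _ hS
  rw [div_le_iff₀ hpos, inv_mul_eq_div, le_div_iff₀ (by positivity)]
  exact amgm κ h0 h1

lemma q_cont {θ : ℝ} (hs : 0 < Real.sin θ) : Continuous (q θ) := by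
  unfold q
  exact Continuous.div (by fun_prop) (by fun_prop) fun r => (den_pos hs r).ne'

lemma q_integral {θ : ℝ} (h0 : 0 < θ) (h1 : θ < Real.pi) :
    ∫ r in (0:ℝ)..1, q θ r = Real.pi / 2 - θ / 2 := by
  have hs := Real.sin_pos_of_pos_of_lt_pi h0 h1
  have hd : ∀ r ∈ Set.uIcc (0:ℝ) 1,
      HasDerivAt (fun r => Real.arctan ((r - Real.cos θ) / Real.sin θ)) (q θ r) r := by
    intro r _
    have h := (((hasDerivAt_id r).sub_const (Real.cos θ)).div_const (Real.sin θ)).arctan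
    refine h.congr_deriv ?_
    have := den_pos hs r
    have e := Real.sin_sq_add_cos_sq θ
    have e2 : 1 + ((id r - Real.cos θ) / Real.sin θ) ^ 2
        = (1 - 2 * r * Real.cos θ + r ^ 2) / Real.sin θ ^ 2 := by
      simp only [id]
      field_simp
      linear_combination e
    rw [e2, q]
    field_simp
  rw [intervalIntegral.integral_eq_sub_of_hasDerivAt hd ((q_cont hs).intervalIntegrable 0 1)]
  have a1 : (1 - Real.cos θ) / Real.sin θ = Real.tan (θ / 2) := by
    have hs2 : 0 < Real.sin (θ / 2) := Real.sin_pos_of_pos_of_lt_pi (by linarith) (by linarith)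
    have hc2 : 0 < Real.cos (θ / 2) := Real.cos_pos_of_mem_Ioo ⟨by linarith, by linarith⟩
    have x1 : Real.cos θ = 2 * Real.cos (θ / 2) ^ 2 - 1 := by
      rw [← Real.cos_two_mul]; ring_nf
    have x2 : Real.sin θ = 2 * Real.sin (θ / 2) * Real.cos (θ / 2) := by
      rw [← Real.sin_two_mul]; ring_nf
    rw [Real.tan_eq_sin_div_cos, div_eq_div_iff hs.ne' hc2.ne', x1, x2]
    have e := Real.sin_sq_add_cos_sq (θ / 2)
    linear_combination (-2 * Real.cos (θ / 2)) * e
  have a2 : (0 - Real.cos θ) / Real.sin θ = Real.tan (θ - Real.pi / 2) := by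
    rw [Real.tan_eq_sin_div_cos, Real.sin_sub_pi_div_two, Real.cos_sub_pi_div_two, zero_sub]
  rw [a1, a2, Real.arctan_tan (by linarith) (by linarith),
    Real.arctan_tan (by linarith) (by linarith)]
  ring

/-- Vaaler's polynomial approximating the sawtooth. -/
noncomputable def V (κ : ℕ) (x : ℝ) : ℝ :=
  -(1 / Real.pi) * ∑ j ∈ Finset.range (κ + 1), ∑ k ∈ Finset.range (κ + 1),
    (∫ r in (0:ℝ)..1, co κ j k r) *
      (Real.sin (2 * Real.pi * x) * Real.cos ((((j : ℤ) - (k : ℤ) : ℤ) : ℝ) * (2 * Real.pi * x)))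

/-- The error term (a Fejér kernel). -/
noncomputable def G (κ : ℕ) (x : ℝ) : ℝ := 1 / (2 * ((κ : ℝ) + 1) ^ 2) * S κ 1 (2 * Real.pi * x)

lemma T_int (κ : ℕ) (θ : ℝ) : IntervalIntegrable (T κ θ) volume 0 1 := by
  unfold T
  have : ∀ j ∈ Finset.range (κ + 1), IntervalIntegrable (fun r => ∑ k ∈ Finset.range (κ + 1),
      co κ j k r * (Real.sin θ * Real.cos ((((j : ℤ) - (k : ℤ) : ℤ) : ℝ) * θ))) volume 0 1 := by
    intro j hj
    have := IntervalIntegrable.sum (μ := volume) (a := 0) (b := 1) (Finset.range (κ + 1))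
      (f := fun k r => co κ j k r * (Real.sin θ * Real.cos ((((j : ℤ) - (k : ℤ) : ℤ) : ℝ) * θ)))
      (fun k hk => by
        rw [Finset.mem_range] at hj hk
        exact (co_integrable (by omega) (by omega)).mul_const _)
    simpa [Finset.sum_fn] using this
  have h := IntervalIntegrable.sum (Finset.range (κ + 1)) this
  simpa [Finset.sum_fn] using h

lemma V_eq (κ : ℕ) (x : ℝ) :
    V κ x = -(1 / Real.pi) * ∫ r in (0:ℝ)..1, T κ (2 * Real.pi * x) r := by
  unfold V T
  congr 1
  have hint : ∀ j ∈ Finset.range (κ + 1), ∀ k ∈ Finset.range (κ + 1),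
      IntervalIntegrable (fun r => co κ j k r * (Real.sin (2 * Real.pi * x) *
        Real.cos ((((j : ℤ) - (k : ℤ) : ℤ) : ℝ) * (2 * Real.pi * x)))) volume 0 1 := by
    intro j hj k hk
    rw [Finset.mem_range] at hj hk
    exact (co_integrable (by omega) (by omega)).mul_const _
  rw [intervalIntegral.integral_finsetSum]
  · refine Finset.sum_congr rfl fun j hj => ?_
    rw [intervalIntegral.integral_finsetSum (hint j hj)]
    refine Finset.sum_congr rfl fun k _ => ?_
    rw [intervalIntegral.integral_mul_const]
  · intro j hj
    have := IntervalIntegrable.sum (Finset.range (κ + 1)) (hint j hj)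
    simpa [Finset.sum_fn] using this

lemma V_tp (κ : ℕ) : IsTrigPolyDeg κ (V κ) := by
  unfold V
  refine tp_smul _ (tp_sum _ _ fun j hj => tp_sum _ _ fun k hk => ?_)
  rw [Finset.mem_range] at hj hk
  by_cases h : j + k = κ
  · simp only [co_zero (show j ≤ κ by omega) (show k ≤ κ by omega) h,
      intervalIntegral.integral_zero, zero_mul]
    exact tp_zero
  · by_cases h' : -(κ : ℤ) < (j : ℤ) - k ∧ (j : ℤ) - k < κ
    · exact tp_smul _ (tp_sincos _ h'.1 h'.2)
    · omega

lemma G_tp (κ : ℕ) : IsTrigPolyDeg κ (G κ) := by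
  unfold G S
  refine tp_smul _ (tp_sum _ _ fun j hj => tp_sum _ _ fun k hk => tp_smul _ ?_)
  rw [Finset.mem_range] at hj hk
  exact tp_cos _ (by omega) (by omega)

lemma V_neg (κ : ℕ) (x : ℝ) : V κ (-x) = - V κ x := by
  simp [V]

lemma G_neg (κ : ℕ) (x : ℝ) : G κ (-x) = G κ x := by
  simp [G, S]

lemma cos_shift (m n : ℤ) (x : ℝ) :
    Real.cos (m * (2 * Real.pi * (x + n))) = Real.cos (m * (2 * Real.pi * x)) := by
  have : (m : ℝ) * (2 * Real.pi * (x + n)) = m * (2 * Real.pi * x) + ((m * n : ℤ) : ℝ) * (2 * Real.pi) := by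
    push_cast; ring
  rw [this, Real.cos_add_int_mul_two_pi]

lemma sin_shift (n : ℤ) (x : ℝ) :
    Real.sin (2 * Real.pi * (x + n)) = Real.sin (2 * Real.pi * x) := by
  have : 2 * Real.pi * (x + n) = 2 * Real.pi * x + n * (2 * Real.pi) := by ring
  rw [this, Real.sin_add_int_mul_two_pi]

lemma V_per (κ : ℕ) (x : ℝ) (n : ℤ) : V κ (x + n) = V κ x := by
  simp only [V, sin_shift, cos_shift]

lemma G_per (κ : ℕ) (x : ℝ) (n : ℤ) : G κ (x + n) = G κ x := by
  simp only [G, S, cos_shift]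

lemma G_nonneg (κ : ℕ) (x : ℝ) : 0 ≤ G κ x :=
  mul_nonneg (by positivity) (S_nonneg _ _ _)

lemma main_half (κ : ℕ) {x : ℝ} (h0 : 0 < x) (h1 : x < 1 / 2) :
    |x - 1 / 2 - V κ x| ≤ G κ x := by
  have hpi := Real.pi_pos
  have t0 : 0 < 2 * Real.pi * x := by positivity
  have t1 : 2 * Real.pi * x < Real.pi := by nlinarith
  have hs := Real.sin_pos_of_pos_of_lt_pi t0 t1
  have hq := q_integral t0 t1
  have hqi := (q_cont hs).intervalIntegrable (μ := volume) 0 1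
  have hTi := T_int κ (2 * Real.pi * x)
  have hV := V_eq κ x
  set θ := 2 * Real.pi * x with hθ
  have i1 : 0 ≤ ∫ r in (0:ℝ)..1, (q θ r - T κ θ r) := by
    have := intervalIntegral.integral_mono_on_of_le_Ioo (f := fun _ => (0:ℝ)) zero_le_one
      (by simp) (hqi.sub hTi) (fun r hr => (T_bound κ hs hr.1.le hr.2).1)
    simpa using this
  have i2 : ∫ r in (0:ℝ)..1, (q θ r - T κ θ r)
      ≤ ∫ r in (0:ℝ)..1, q θ r * (S κ 1 θ / ((κ : ℝ) + 1) ^ 2) :=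
    intervalIntegral.integral_mono_on_of_le_Ioo zero_le_one
      (hqi.sub hTi) (hqi.mul_const _) (fun r hr => (T_bound κ hs hr.1.le hr.2).2)
  rw [intervalIntegral.integral_mul_const, hq] at i2
  rw [intervalIntegral.integral_sub hqi hTi, hq] at i1 i2
  set I := ∫ r in (0:ℝ)..1, T κ θ r with hI
  have hS := S_nonneg κ 1 θ
  have e : x - 1 / 2 - V κ x = -((Real.pi / 2 - θ / 2 - I) / Real.pi) := by
    rw [hV, hθ]; field_simp; ring
  rw [e, abs_neg, abs_of_nonneg (div_nonneg i1 hpi.le), div_le_iff₀ hpi]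
  refine i2.trans ?_
  rw [G, ← hθ]
  have : (Real.pi / 2 - θ / 2) * (S κ 1 θ / ((κ : ℝ) + 1) ^ 2)
      ≤ (Real.pi / 2) * (S κ 1 θ / ((κ : ℝ) + 1) ^ 2) := by
    gcongr; linarith
  refine this.trans (le_of_eq ?_)
  field_simp

lemma main_unit (κ : ℕ) {x : ℝ} (h0 : 0 ≤ x) (h1 : x < 1) :
    |x - 1 / 2 - V κ x| ≤ G κ x := by
  rcases h0.eq_or_lt with rfl | h0
  · have : V κ 0 = 0 := by simp [V]
    rw [this, G, mul_zero, S_zero_one]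
    rw [show (0 : ℝ) - 1 / 2 - 0 = -(1 / 2) by ring, abs_neg, abs_of_nonneg (by norm_num)]
    apply le_of_eq
    field_simp
  rcases lt_trichotomy x (1 / 2) with h | h | h
  · exact main_half κ h0 h
  · have : V κ x = 0 := by
      rw [V, h, show 2 * Real.pi * (1 / 2) = Real.pi by ring]; simp
    rw [this, h]
    simpa using G_nonneg κ (1 / 2)
  · have hh := main_half κ (x := 1 - x) (by linarith) (by linarith)
    have e1 : V κ (1 - x) = - V κ x := by
      have := V_per κ (-x) 1
      rw [V_neg] at this
      rw [← this]; congr 1; push_cast; ring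
    have e2 : G κ (1 - x) = G κ x := by
      have := G_per κ (-x) 1
      rw [G_neg] at this
      rw [← this]; congr 1; push_cast; ring
    rw [e1, e2] at hh
    rw [← abs_neg]
    convert hh using 2
    ring

lemma main_bound (κ : ℕ) (x : ℝ) : |Int.fract x - 1 / 2 - V κ x| ≤ G κ x := by
  have h := main_unit κ (Int.fract_nonneg x) (Int.fract_lt_one x)
  have e : Int.fract x = x + ((-⌊x⌋ : ℤ) : ℝ) := by
    rw [Int.fract]; push_cast; ring
  rw [show V κ x = V κ (Int.fract x) by rw [e, V_per],
    show G κ x = G κ (Int.fract x) by rw [e, G_per]]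
  exact h

lemma cos_int (m : ℤ) (a : ℝ) : ∫ x in (0:ℝ)..1, Real.cos (m * (2 * Real.pi * (x - a)))
    = if m = 0 then 1 else 0 := by
  split_ifs with h
  · simp [h]
  · have hm : (m : ℝ) ≠ 0 := by exact_mod_cast h
    have hpi := Real.pi_pos.ne'
    have hd : ∀ x ∈ Set.uIcc (0:ℝ) 1, HasDerivAt
        (fun x => Real.sin (m * (2 * Real.pi * (x - a))) / (m * (2 * Real.pi)))
        (Real.cos (m * (2 * Real.pi * (x - a)))) x := by
      intro x _
      have h1 := (((((hasDerivAt_id x).sub_const a).const_mul (2 * Real.pi)).const_mul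
        (m : ℝ)).sin).div_const (m * (2 * Real.pi))
      refine h1.congr_deriv ?_
      simp only [id]
      field_simp
    rw [intervalIntegral.integral_eq_sub_of_hasDerivAt hd
      (Continuous.intervalIntegrable (by fun_prop) 0 1)]
    have : (m : ℝ) * (2 * Real.pi * (1 - a)) = m * (2 * Real.pi * (0 - a)) + m * (2 * Real.pi) := by
      ring
    rw [this, Real.sin_add_int_mul_two_pi, sub_self]

lemma G_integral (κ : ℕ) (a : ℝ) : ∫ x in (0:ℝ)..1, G κ (x - a) = 1 / (2 * ((κ : ℝ) + 1)) := by
  simp only [G, S]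
  rw [intervalIntegral.integral_const_mul, intervalIntegral.integral_finsetSum
    (fun j _ => Continuous.intervalIntegrable (by fun_prop) 0 1)]
  have : ∀ j ∈ Finset.range (κ + 1), ∫ x in (0:ℝ)..1, ∑ k ∈ Finset.range (κ + 1),
      (1:ℝ) ^ (j + k) * Real.cos ((((j : ℤ) - (k : ℤ) : ℤ) : ℝ) * (2 * Real.pi * (x - a))) = 1 := by
    intro j hj
    rw [intervalIntegral.integral_finsetSum
      (fun j _ => Continuous.intervalIntegrable (by fun_prop) 0 1)]
    simp only [one_pow, one_mul, cos_int, sub_eq_zero, Nat.cast_inj]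
    rw [Finset.sum_ite_eq, if_pos hj]
  rw [Finset.sum_congr rfl this]
  simp
  field_simp

lemma G_cont (κ : ℕ) : Continuous (G κ) := by
  unfold G S
  fun_prop

lemma indicator_eq (a b : ℝ) (ha : 0 ≤ a) (hab : a ≤ b) (hb : b ≤ 1) (x : ℝ) :
    (if Int.fract x ∈ Set.Ico a b then (1:ℝ) else 0)
      = b - a + (Int.fract (x - b) - 1 / 2) - (Int.fract (x - a) - 1 / 2) := by
  have h0 := Int.fract_nonneg x
  have h1 := Int.fract_lt_one x
  have ex : x = Int.fract x + ⌊x⌋ := (Int.fract_add_floor x).symm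
  have red : ∀ c, Int.fract (x - c) = Int.fract (Int.fract x - c) := by
    intro c
    conv_lhs => rw [ex]
    rw [show Int.fract x + (⌊x⌋ : ℝ) - c = Int.fract x - c + (⌊x⌋ : ℝ) by ring,
      Int.fract_add_intCast]
  rw [red, red]
  set y := Int.fract x
  have up : ∀ c, c ≤ 1 → c ≤ y → 0 ≤ c → Int.fract (y - c) = y - c := by
    intro c _ h2 h3
    rw [Int.fract_eq_self]; constructor <;> linarith
  have dn : ∀ c, c ≤ 1 → y < c → Int.fract (y - c) = y - c + 1 := by
    intro c h2 h3
    rw [Int.fract_eq_iff]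
    exact ⟨by linarith, by linarith, -1, by push_cast; ring⟩
  split_ifs with h
  · rw [up a (by linarith) h.1 ha, dn b hb h.2]; ring
  · rw [Set.mem_Ico, not_and_or, not_le, not_lt] at h
    rcases h with h | h
    · rw [dn a (by linarith) h, dn b hb (by linarith)]; ring
    · rw [up a (by linarith) (by linarith) ha, up b hb h (by linarith)]; ring

end Vaaler

open Vaaler in
/-- For the characteristic function of an interval `I ⊆ ℝ/ℤ` (here the indicator of
`[a, b) ⊆ [0, 1)` extended `1`-periodically) and any positive integer `κ`, there exist
trigonometric polynomials `P⁻ ≤ 1_I ≤ P⁺` of degree at most `κ` with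
`∫ (P⁺ − P⁻) ≤ 2/(κ+1)`. -/
theorem stmt_11 (a b : ℝ) (ha : 0 ≤ a) (hab : a ≤ b) (hb : b ≤ 1)
    (f : ℝ → ℝ) (hf : ∀ x : ℝ, f x = if Int.fract x ∈ Set.Ico a b then 1 else 0)
    (κ : ℕ) (hκ : 0 < κ) :
    ∃ Pm Pp : ℝ → ℝ, IsTrigPolyDeg κ Pm ∧ IsTrigPolyDeg κ Pp ∧
      (∀ x : ℝ, Pm x ≤ f x) ∧ (∀ x : ℝ, f x ≤ Pp x) ∧
      (∫ x in (0:ℝ)..1, (Pp x - Pm x)) ≤ 2 / (κ + 1) := by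
  have hM : IsTrigPolyDeg κ (fun x => b - a + V κ (x - b) + (-1) * V κ (x - a)) :=
    tp_add (tp_add (tp_const _) (tp_shift b (V_tp κ))) (tp_smul _ (tp_shift a (V_tp κ)))
  have hE : IsTrigPolyDeg κ (fun x => G κ (x - b) + G κ (x - a)) :=
    tp_add (tp_shift b (G_tp κ)) (tp_shift a (G_tp κ))
  have key : ∀ x, |f x - (b - a + V κ (x - b) + (-1) * V κ (x - a))|
      ≤ G κ (x - b) + G κ (x - a) := by
    intro x
    have h1 := abs_le.mp (main_bound κ (x - b))
    have h2 := abs_le.mp (main_bound κ (x - a))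
    rw [hf, indicator_eq a b ha hab hb, abs_le]
    constructor <;> linarith [h1.1, h1.2, h2.1, h2.2]
  refine ⟨_, _, tp_add hM (tp_smul (-1) hE), tp_add hM hE, fun x => ?_, fun x => ?_, ?_⟩
  · have := abs_le.mp (key x)
    linarith [this.1]
  · have := abs_le.mp (key x)
    linarith [this.2]
  · have hG := G_cont κ
    have : ∀ x, (b - a + V κ (x - b) + -1 * V κ (x - a) + (G κ (x - b) + G κ (x - a)) -
        (b - a + V κ (x - b) + -1 * V κ (x - a) + -1 * (G κ (x - b) + G κ (x - a))))
        = 2 * (G κ (x - b) + G κ (x - a)) := fun x => by ring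
    simp only [this]
    rw [intervalIntegral.integral_const_mul, intervalIntegral.integral_add
      (Continuous.intervalIntegrable (by fun_prop) 0 1)
      (Continuous.intervalIntegrable (by fun_prop) 0 1), G_integral, G_integral]
    apply le_of_eq
    field_simp
    ring
end
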